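/- arXiv:1501.07215 — 7 statements merged into one kernel-verified Lean document; each statement's English description precedes it below -/
import Mathlib

section
/- Let T be a set functor and Λ a set of monotone predicate liftings for T. There is an inductively defined translation (·)^◇ mapping each formula φ of the coalgebraic μ-calculus μML_Λ to a formula φ^◇ of the coalgebraic monadic second-order logic MSO_Λ such that for every pointed T-model (𝕊,s): (𝕊,s) ⊨ φ if and only if (𝕊,s) ⊨ φ^◇. -/
open scoped Classical

/-- A set functor: an endofunctor on the category of sets (types in `Type`). -/
structure SetFunctor where
  obj : Type → Type
  map : {X Y : Type} → (X → Y) → obj X → obj Y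
  map_id : ∀ {X : Type} (x : obj X), map id x = x
  map_comp : ∀ {X Y Z : Type} (f : X → Y) (g : Y → Z) (x : obj X),
    map (g ∘ f) x = map g (map f x)

/-- An `n`-place predicate lifting for `T`: a natural transformation `𝒬(-)ⁿ → 𝒬 ∘ T`. -/
structure PredLifting (T : SetFunctor) (n : ℕ) where
  app : (X : Type) → (Fin n → Set X) → Set (T.obj X)
  natural : ∀ {X Y : Type} (f : X → Y) (V : Fin n → Set Y),
    app X (fun i => f ⁻¹' V i) = T.map f ⁻¹' app Y V

/-- Monotonicity of a predicate lifting. -/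
def PredLifting.Mono {T : SetFunctor} {n : ℕ} (l : PredLifting T n) : Prop :=
  ∀ (X : Type) (V V' : Fin n → Set X), (∀ i, V i ⊆ V' i) → l.app X V ⊆ l.app X V'

/-- A set `Λ` of monotone predicate liftings for `T`, presented as an indexed family. -/
structure LiftingFamily (T : SetFunctor) where
  ι : Type
  ar : ι → ℕ
  lf : (i : ι) → PredLifting T (ar i)
  mono : ∀ i, (lf i).Mono

/-- Updating a valuation at one proposition letter. -/
noncomputable def updV {X : Type} (V : ℕ → Set X) (p : ℕ) (Z : Set X) : ℕ → Set X :=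
  fun q => if q = p then Z else V q

/-- Formulas of the coalgebraic μ-calculus `μML_Λ` (in negation normal form). -/
inductive MuForm {T : SetFunctor} (F : LiftingFamily T) : Type
  | var (p : ℕ)
  | nvar (p : ℕ)
  | bot
  | top
  | lift (i : F.ι) (arg : Fin (F.ar i) → MuForm F)
  | or (φ ψ : MuForm F)
  | and (φ ψ : MuForm F)
  | mu (p : ℕ) (φ : MuForm F)
  | nu (p : ℕ) (φ : MuForm F)

/-- `φ.PosIn p`: no free occurrence of `p` is negated in `φ`. -/
def MuForm.PosIn {T : SetFunctor} {F : LiftingFamily T} (p : ℕ) : MuForm F → Prop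
  | .var _ => True
  | .nvar q => q ≠ p
  | .bot => True
  | .top => True
  | .lift _ arg => ∀ k, (arg k).PosIn p
  | .or φ ψ => φ.PosIn p ∧ ψ.PosIn p
  | .and φ ψ => φ.PosIn p ∧ ψ.PosIn p
  | .mu q φ => q = p ∨ φ.PosIn p
  | .nu q φ => q = p ∨ φ.PosIn p

/-- Well-formedness: in every subformula `μp.φ` or `νp.φ`, no free occurrence of the
bound variable `p` lies in the scope of a negation. -/
def MuForm.WF {T : SetFunctor} {F : LiftingFamily T} : MuForm F → Prop
  | .var _ => True
  | .nvar _ => True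
  | .bot => True
  | .top => True
  | .lift _ arg => ∀ k, (arg k).WF
  | .or φ ψ => φ.WF ∧ ψ.WF
  | .and φ ψ => φ.WF ∧ ψ.WF
  | .mu p φ => φ.PosIn p ∧ φ.WF
  | .nu p φ => φ.PosIn p ∧ φ.WF

/-- Semantics of `μML_Λ`: the truth set of a formula in a `T`-coalgebra `(S,σ)` under a
valuation `V`, with `μ`/`ν` interpreted as least/greatest fixpoints. -/
noncomputable def MuForm.sem {T : SetFunctor} {F : LiftingFamily T} {S : Type}
    (σ : S → T.obj S) : MuForm F → (ℕ → Set S) → Set S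
  | .var p, V => V p
  | .nvar p, V => (V p)ᶜ
  | .bot, _ => ∅
  | .top, _ => Set.univ
  | .lift i arg, V => {s : S | σ s ∈ (F.lf i).app S (fun k => (arg k).sem σ V)}
  | .or φ ψ, V => φ.sem σ V ∪ ψ.sem σ V
  | .and φ ψ, V => φ.sem σ V ∩ ψ.sem σ V
  | .mu p φ, V => ⋂₀ {Z : Set S | φ.sem σ (updV V p Z) ⊆ Z}
  | .nu p φ, V => ⋃₀ {Z : Set S | Z ⊆ φ.sem σ (updV V p Z)}

/-- Formulas of coalgebraic monadic second-order logic `MSO_Λ`. -/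
inductive MSOForm {T : SetFunctor} (F : LiftingFamily T) : Type
  | bot
  | sr (p : ℕ)
  | subset (p q : ℕ)
  | lift (i : F.ι) (p : ℕ) (q : Fin (F.ar i) → ℕ)
  | or (φ ψ : MSOForm F)
  | neg (φ : MSOForm F)
  | ex (p : ℕ) (φ : MSOForm F)

/-- Satisfaction of `MSO_Λ`-formulas in a pointed `T`-model. -/
def MSOForm.sat {T : SetFunctor} {F : LiftingFamily T} {S : Type} (σ : S → T.obj S) :
    MSOForm F → (ℕ → Set S) → S → Prop
  | .bot, _, _ => False
  | .sr p, V, u => V p = {u}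
  | .subset p q, V, _ => V p ⊆ V q
  | .lift i p qs, V, _ => ∀ v ∈ V p, σ v ∈ (F.lf i).app S (fun k => V (qs k))
  | .or φ ψ, V, u => φ.sat σ V u ∨ ψ.sat σ V u
  | .neg φ, V, u => ¬ φ.sat σ V u
  | .ex p φ, V, u => ∃ Z : Set S, φ.sat σ (updV V p Z) u

section Translation

variable {T : SetFunctor} {F : LiftingFamily T}

@[simp]
theorem updV_same {X : Type} (V : ℕ → Set X) (p : ℕ) (Z : Set X) : updV V p Z p = Z :=
  if_pos rfl

theorem updV_of_ne {X : Type} (V : ℕ → Set X) {p q : ℕ} (Z : Set X) (h : q ≠ p) :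
    updV V p Z q = V q :=
  if_neg h

namespace MSOForm

/-- Implication. -/
def imp (φ ψ : MSOForm F) : MSOForm F := .or (.neg φ) ψ

/-- Conjunction. -/
def and (φ ψ : MSOForm F) : MSOForm F := .neg (.or (.neg φ) (.neg ψ))

/-- Universal quantification. -/
def all (p : ℕ) (φ : MSOForm F) : MSOForm F := .neg (.ex p (.neg φ))

/-- Conjunction of a list of formulas. -/
def conj : List (MSOForm F) → MSOForm F
  | [] => .neg .bot
  | φ :: l => φ.and (conj l)

/-- Existential quantification over the letters `r, …, r + n - 1`. -/
def exs (r : ℕ) : ℕ → MSOForm F → MSOForm F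
  | 0, φ => φ
  | n + 1, φ => .ex (r + n) (exs r n φ)

variable {S : Type} (σ : S → T.obj S) (V : ℕ → Set S) (u : S)

@[simp]
theorem sat_imp (φ ψ : MSOForm F) :
    (φ.imp ψ).sat σ V u ↔ (φ.sat σ V u → ψ.sat σ V u) := by
  simp only [imp, sat]; tauto

@[simp]
theorem sat_and (φ ψ : MSOForm F) :
    (φ.and ψ).sat σ V u ↔ φ.sat σ V u ∧ ψ.sat σ V u := by
  simp only [and, sat]; tauto

@[simp]
theorem sat_all (p : ℕ) (φ : MSOForm F) :
    (φ.all p).sat σ V u ↔ ∀ Z : Set S, φ.sat σ (updV V p Z) u := by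
  simp [all, sat]

theorem sat_conj (l : List (MSOForm F)) :
    (conj l).sat σ V u ↔ ∀ φ ∈ l, φ.sat σ V u := by
  induction l with
  | nil => simp [conj, sat]
  | cons φ l ih => simp [conj, ih]

theorem sat_exs (r n : ℕ) (φ : MSOForm F) :
    (exs r n φ).sat σ V u ↔
      ∃ W : ℕ → Set S, (∀ q, q < r ∨ r + n ≤ q → W q = V q) ∧ φ.sat σ W u := by
  induction n generalizing V with
  | zero =>
    constructor
    · exact fun h => ⟨V, fun _ _ => rfl, h⟩
    · rintro ⟨W, hW, h⟩
      have : W = V := funext fun q => hW q (by omega)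
      exact this ▸ h
  | succ n ih =>
    simp only [exs, sat, ih]
    constructor
    · rintro ⟨Z, W, hW, h⟩
      refine ⟨W, fun q hq => ?_, h⟩
      rw [hW q (by omega), updV_of_ne _ _ (by omega)]
    · rintro ⟨W, hW, h⟩
      refine ⟨W (r + n), W, fun q hq => ?_, h⟩
      by_cases hqn : q = r + n
      · simp [hqn]
      · rw [updV_of_ne _ _ hqn, hW q (by omega)]

end MSOForm

namespace MuForm

/-- A strict upper bound on the letters that occur, free or bound, in a formula. -/
def bound : MuForm F → ℕ
  | .var p => p + 1
  | .nvar p => p + 1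
  | .bot => 0
  | .top => 0
  | .lift _ arg => Finset.univ.sup fun k => (arg k).bound
  | .or φ ψ => max φ.bound ψ.bound
  | .and φ ψ => max φ.bound ψ.bound
  | .mu p φ => max (p + 1) φ.bound
  | .nu p φ => max (p + 1) φ.bound

/-- For `r` not below `φ.bound`, a formula expressing that `r` is contained in the truth
set of `φ`. -/
def incl : MuForm F → ℕ → MSOForm F
  | .var p, r => .subset r p
  | .nvar p, r =>
    .all (r + 1) (.imp (.and (.subset (r + 1) r) (.subset (r + 1) p))
      (.all (r + 2) (.subset (r + 1) (r + 2))))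
  | .bot, r => .all (r + 1) (.subset r (r + 1))
  | .top, _ => .neg .bot
  | .lift i arg, r =>
    .exs (r + 1) (F.ar i) (.and (.lift i r fun k => r + 1 + k)
      (.conj (List.ofFn fun k => (arg k).incl (r + 1 + k))))
  | .or φ ψ, r =>
    .ex (r + 1) (.ex (r + 2) (.and (.and (φ.incl (r + 1)) (ψ.incl (r + 2)))
      (.all (r + 3) (.imp (.subset (r + 1) (r + 3))
        (.imp (.subset (r + 2) (r + 3)) (.subset r (r + 3)))))))
  | .and φ ψ, r => .and (φ.incl r) (ψ.incl r)
  | .mu p φ, r =>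
    .all p (.imp (.all (r + 1) (.imp (φ.incl (r + 1)) (.subset (r + 1) p))) (.subset r p))
  | .nu p φ, r =>
    .all (r + 1) (.imp
      (.all p (.imp (.ex (r + 2) (.and (.subset p (r + 2)) (φ.incl (r + 2))))
        (.subset p (r + 1))))
      (.subset r (r + 1)))

/-- The translation of the `μ`-calculus into monadic second-order logic. -/
def toMSO (φ : MuForm F) : MSOForm F :=
  .ex φ.bound (.and (.sr φ.bound) (φ.incl φ.bound))

theorem sat_incl {S : Type} (σ : S → T.obj S) (u : S) (φ : MuForm F) {r : ℕ}
    (hr : φ.bound ≤ r) {V W : ℕ → Set S} (hVW : ∀ q < φ.bound, V q = W q) :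
    (φ.incl r).sat σ V u ↔ V r ⊆ φ.sem σ W := by
  induction φ generalizing r V W with
  | var p => simp [incl, MSOForm.sat, sem, hVW p (by simp [bound])]
  | nvar p =>
    have hp : p < r := hr
    rw [sem, ← hVW p (by simp [bound])]
    simp only [incl, MSOForm.sat_all, MSOForm.sat_imp, MSOForm.sat_and, MSOForm.sat, updV_same,
      updV_of_ne _ _ (show r ≠ r + 1 by omega), updV_of_ne _ _ (show p ≠ r + 1 by omega),
      updV_of_ne _ _ (show r + 1 ≠ r + 2 by omega)]
    constructor
    · intro h x hx hxp
      exact h {x} ⟨by simpa, by simpa⟩ ∅ rfl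
    · intro h C hC Z x hx
      exact absurd (hC.2 hx) (h (hC.1 hx))
  | bot =>
    simp only [incl, MSOForm.sat_all, MSOForm.sat, updV_same, sem,
      updV_of_ne _ _ (show r ≠ r + 1 by omega)]
    exact ⟨fun h => h ∅, fun h Z => h.trans (Set.empty_subset Z)⟩
  | top => simp [incl, MSOForm.sat, sem]
  | lift i arg ih =>
    have hb (k) : (arg k).bound ≤ (MuForm.lift i arg).bound :=
      Finset.le_sup (f := fun k => (arg k).bound) (Finset.mem_univ k)
    have key (V' : ℕ → Set S) (hV' : ∀ q, q < r + 1 ∨ r + 1 + F.ar i ≤ q → V' q = V q) (k) :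
        ((arg k).incl (r + 1 + k)).sat σ V' u ↔ V' (r + 1 + k) ⊆ (arg k).sem σ W := by
      have := hb k
      exact ih k (by omega) fun q hq => (hV' q (by omega)).trans (hVW q (by omega))
    simp only [incl, MSOForm.sat_exs, MSOForm.sat_and, MSOForm.sat_conj, List.forall_mem_ofFn_iff,
      MSOForm.sat]
    constructor
    · rintro ⟨V', hV', hl, ha⟩ x hx
      refine F.mono i S _ _ (fun k => (key V' hV' k).1 (ha k)) (hl x ?_)
      rwa [hV' r (by omega)]
    · intro h
      let V' : ℕ → Set S := fun q =>
        if hq : r + 1 ≤ q ∧ q < r + 1 + F.ar i then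
          (arg ⟨q - (r + 1), by omega⟩).sem σ W else V q
      have hV' : ∀ q, q < r + 1 ∨ r + 1 + F.ar i ≤ q → V' q = V q :=
        fun q hq => dif_neg (by omega)
      have hk (k : Fin (F.ar i)) : V' (r + 1 + k) = (arg k).sem σ W := by
        refine (dif_pos (by omega)).trans ?_
        simp
      refine ⟨V', hV', fun x hx => ?_, fun k => (key V' hV' k).2 (hk k).subset⟩
      rw [hV' r (by omega)] at hx
      simp only [hk]
      exact h hx
  | or φ ψ ihφ ihψ =>
    simp only [bound, max_le_iff, lt_max_iff] at hr hVW
    have key (A B : Set S) (q) (h : q < r + 1) : updV (updV V (r + 1) A) (r + 2) B q = V q := by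
      rw [updV_of_ne _ _ (by omega), updV_of_ne _ _ (by omega)]
    have hφ (A B : Set S) := ihφ (r := r + 1) (by omega)
      (V := updV (updV V (r + 1) A) (r + 2) B) (W := W)
      fun q hq => (key A B q (by omega)).trans (hVW q (.inl hq))
    have hψ (A B : Set S) := ihψ (r := r + 2) (by omega)
      (V := updV (updV V (r + 1) A) (r + 2) B) (W := W)
      fun q hq => (key A B q (by omega)).trans (hVW q (.inr hq))
    simp only [incl, MSOForm.sat_all, MSOForm.sat_imp, MSOForm.sat_and, MSOForm.sat, hφ, hψ,
      updV_same, updV_of_ne _ _ (show r + 1 ≠ r + 2 by omega),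
      updV_of_ne _ _ (show r + 1 ≠ r + 3 by omega), updV_of_ne _ _ (show r + 2 ≠ r + 3 by omega),
      updV_of_ne _ _ (show r ≠ r + 3 by omega), updV_of_ne _ _ (show r ≠ r + 2 by omega),
      updV_of_ne _ _ (show r ≠ r + 1 by omega), sem]
    constructor
    · rintro ⟨A, B, ⟨hA, hB⟩, h⟩
      exact h _ (hA.trans Set.subset_union_left) (hB.trans Set.subset_union_right)
    · exact fun h => ⟨_, _, ⟨subset_rfl, subset_rfl⟩,
        fun C hA hB => h.trans (Set.union_subset hA hB)⟩
  | and φ ψ ihφ ihψ =>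
    simp only [bound, max_le_iff, lt_max_iff] at hr hVW
    simp only [incl, MSOForm.sat_and, sem, Set.subset_inter_iff,
      ihφ hr.1 fun q hq => hVW q (.inl hq), ihψ hr.2 fun q hq => hVW q (.inr hq)]
  | mu p φ ih =>
    simp only [bound, max_le_iff, lt_max_iff] at hr hVW
    have key (Z C : Set S) := ih (r := r + 1) (by omega)
      (V := updV (updV V p Z) (r + 1) C) (W := updV W p Z) fun q hq => by
        rw [updV_of_ne _ _ (by omega)]
        by_cases hqp : q = p
        · simp [hqp]
        · rw [updV_of_ne _ _ hqp, updV_of_ne _ _ hqp, hVW q (.inr hq)]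
    simp only [incl, MSOForm.sat_all, MSOForm.sat_imp, MSOForm.sat, key, updV_same,
      updV_of_ne _ _ (show p ≠ r + 1 by omega), updV_of_ne _ _ (show r ≠ p by omega), sem,
      Set.subset_sInter_iff, Set.mem_ofPred_eq]
    exact forall_congr' fun Z =>
      imp_congr_left ⟨fun h => h _ subset_rfl, fun h C hC => hC.trans h⟩
  | nu p φ ih =>
    simp only [bound, max_le_iff, lt_max_iff] at hr hVW
    have key (C Z D : Set S) := ih (r := r + 2) (by omega)
      (V := updV (updV (updV V (r + 1) C) p Z) (r + 2) D) (W := updV W p Z) fun q hq => by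
        rw [updV_of_ne _ _ (by omega)]
        by_cases hqp : q = p
        · simp [hqp]
        · rw [updV_of_ne _ _ hqp, updV_of_ne _ _ hqp, updV_of_ne _ _ (by omega), hVW q (.inr hq)]
    simp only [incl, MSOForm.sat_all, MSOForm.sat_imp, MSOForm.sat_and, MSOForm.sat, key,
      updV_same, updV_of_ne _ _ (show p ≠ r + 2 by omega),
      updV_of_ne _ _ (show r + 1 ≠ p by omega), updV_of_ne _ _ (show r ≠ r + 1 by omega), sem]
    constructor
    · exact fun h => h _ fun Z ⟨D, hZD, hD⟩ => Set.subset_sUnion_of_mem (hZD.trans hD)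
    · exact fun h C hC => h.trans (Set.sUnion_subset fun Z hZ => hC Z ⟨Z, subset_rfl, hZ⟩)

theorem sat_toMSO {S : Type} (σ : S → T.obj S) (V : ℕ → Set S) (u : S) (φ : MuForm F) :
    φ.toMSO.sat σ V u ↔ u ∈ φ.sem σ V := by
  have key (Z : Set S) := sat_incl σ u φ le_rfl (V := updV V φ.bound Z) (W := V)
    fun q hq => updV_of_ne _ _ hq.ne
  simp [toMSO, MSOForm.sat, key]

end MuForm

end Translation

/-- There is a translation `(·)^◇` mapping each formula of the
coalgebraic μ-calculus `μML_Λ` to a formula of coalgebraic monadic second-order logic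
`MSO_Λ` which is equivalent to it over all pointed `T`-models. -/
theorem mu_calculus_translates_into_mso (T : SetFunctor) (F : LiftingFamily T) :
    ∃ tr : MuForm F → MSOForm F,
      ∀ φ : MuForm F, φ.WF →
        ∀ (S : Type) (σ : S → T.obj S) (V : ℕ → Set S) (u : S),
          u ∈ φ.sem σ V ↔ (tr φ).sat σ V u :=
  ⟨MuForm.toMSO, fun φ _ _ σ V u => (φ.sat_toMSO σ V u).symm⟩
end

section
/- Let T be a set functor and Λ any set of monotone predicate liftings for T. Every second-order Λ-automaton 𝔸 ∈ Aut(SO_Λ) is equivalent (accepts exactly the same T-tree models) to a monotone automaton 𝔸′ ∈ Aut(SO_Λ), i.e., one in which every one-step sentence Δ′(a,c), regarded as a generalized predicate lifting over the state set, is monotone. -/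
open scoped Classical

/-- A generalized predicate lifting over a set `A` of variables. -/
structure GenLifting (T : SetFunctor) (A : Type) where
  app : (X : Type) → (A → Set X) → Set (T.obj X)

/-- Monotonicity for generalized predicate liftings. -/
def GenLifting.Mono {T : SetFunctor} {A : Type} (φ : GenLifting T A) : Prop :=
  ∀ (X : Type) (V V' : A → Set X), (∀ a : A, V a ⊆ V' a) → φ.app X V ⊆ φ.app X V'

/-- Naturality for generalized predicate liftings. -/
def GenLifting.Natural {T : SetFunctor} {A : Type} (φ : GenLifting T A) : Prop :=
  ∀ (X Y : Type) (f : X → Y) (V : A → Set Y),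
    φ.app X (fun a => f ⁻¹' V a) = T.map f ⁻¹' φ.app Y V

/-- Formulas of the one-step second-order language over variables `W`
(relative to the liftings in `F`). -/
inductive SOForm {T : SetFunctor} (F : LiftingFamily T) (W : Type) : Type
  | subset (a b : W)
  | lift (i : F.ι) (v : Fin (F.ar i) → W)
  | neg (φ : SOForm F W)
  | or (φ ψ : SOForm F W)
  | ex (w : W) (φ : SOForm F W)

/-- Updating a valuation at one variable. -/
noncomputable def updW {W X : Type} (V : W → Set X) (w : W) (Z : Set X) : W → Set X :=
  fun w' => if w' = w then Z else V w'

/-- One-step satisfaction of second-order one-step formulas in a one-step model `(X, α, V)`. -/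
def SOForm.sat {T : SetFunctor} {F : LiftingFamily T} {W : Type} (X : Type) (α : T.obj X) :
    SOForm F W → (W → Set X) → Prop
  | .subset a b, V => V a ⊆ V b
  | .lift i v, V => α ∈ (F.lf i).app X (fun k => V (v k))
  | .neg φ, V => ¬ φ.sat X α V
  | .or φ ψ, V => φ.sat X α V ∨ ψ.sat X α V
  | .ex w φ, V => ∃ Z : Set X, φ.sat X α (updW V w Z)

/-- Free variables of a one-step second-order formula. -/
def SOForm.fv {T : SetFunctor} {F : LiftingFamily T} {W : Type} : SOForm F W → Set W
  | .subset a b => {a, b}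
  | .lift _ v => Set.range v
  | .neg φ => φ.fv
  | .or φ ψ => φ.fv ∪ ψ.fv
  | .ex w φ => φ.fv \ {w}

/-- Quantifier depth of a one-step second-order formula. -/
def SOForm.qd {T : SetFunctor} {F : LiftingFamily T} {W : Type} : SOForm F W → ℕ
  | .subset _ _ => 0
  | .lift _ _ => 0
  | .neg φ => φ.qd
  | .or φ ψ => max φ.qd ψ.qd
  | .ex _ φ => φ.qd + 1

/-- A one-step second-order sentence over `A`: a formula over `A ⊕ ℕ` all of whose
free variables come from `A`. -/
def IsSentence {T : SetFunctor} {F : LiftingFamily T} {A : Type}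
    (φ : SOForm F (A ⊕ ℕ)) : Prop :=
  ∀ w ∈ φ.fv, ∃ a : A, w = Sum.inl a

/-- Satisfaction of a sentence over `A` at a one-step model `(X, α, V)` with
`V : A → Set X` (bound variables are initialized arbitrarily). -/
def SOForm.sat0 {T : SetFunctor} {F : LiftingFamily T} {A : Type} (X : Type) (α : T.obj X)
    (φ : SOForm F (A ⊕ ℕ)) (V : A → Set X) : Prop :=
  φ.sat X α (Sum.elim V (fun _ => (∅ : Set X)))

/-- The generalized predicate lifting induced by a one-step second-order sentence. -/
def SOForm.toLifting {T : SetFunctor} {F : LiftingFamily T} {A : Type}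
    (φ : SOForm F (A ⊕ ℕ)) : GenLifting T A :=
  ⟨fun X V => {α : T.obj X | φ.sat0 X α V}⟩

/-- `RPath R s t l`: `l` is the list of successive nodes (after `s`) of an `R`-path
from `s` to `t`. -/
inductive RPath {S : Type} (R : S → S → Prop) : S → S → List S → Prop
  | nil (s : S) : RPath R s s []
  | cons {s t w : S} {l : List S} : R s t → RPath R t w l → RPath R s w (t :: l)

/-- A `T`-tree model: a `T`-model with a supporting Kripke frame `R` (witnessed by the
local coalgebra structure `σloc`) such that `(S,R)` is a tree rooted at `root`. -/
structure TreeModel (T : SetFunctor) where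
  S : Type
  σ : S → T.obj S
  V : ℕ → Set S
  R : S → S → Prop
  root : S
  σloc : (s : S) → T.obj {t : S // R s t}
  σloc_spec : ∀ s : S, T.map (Subtype.val) (σloc s) = σ s
  tree : ∀ w : S, ∃! l : List S, RPath R root w l

/-- A `P`-chromatic second-order `Λ`-automaton. -/
structure SOAutomaton (T : SetFunctor) (F : LiftingFamily T) where
  P : Set ℕ
  Pfin : P.Finite
  St : Type
  fin : Finite St
  aI : St
  Ω : St → ℕ
  Δ : St → Set ℕ → SOForm F (St ⊕ ℕ)
  sentence : ∀ (a : St) (c : Set ℕ), IsSentence (Δ a c)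

/-- The colour of a state of a tree model. -/
def SOAutomaton.color {T : SetFunctor} {F : LiftingFamily T} (aut : SOAutomaton T F)
    (M : TreeModel T) (s : M.S) : Set ℕ :=
  {p | p ∈ aut.P ∧ s ∈ M.V p}

/-- Legality of ∃'s moves in the acceptance game. -/
def SOAutomaton.Legal {T : SetFunctor} {F : LiftingFamily T} (aut : SOAutomaton T F)
    (M : TreeModel T) (a : aut.St) (s : M.S) (U : aut.St → Set M.S) : Prop :=
  (∀ b : aut.St, U b ⊆ {t : M.S | M.R s t}) ∧
  (aut.Δ a (aut.color M s)).sat0 {t : M.S // M.R s t} (M.σloc s)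
    (fun b => {t : {t' : M.S // M.R s t'} | t.1 ∈ U b})

/-- Histories of the acceptance game reachable under strategy `st`. -/
inductive SOReach {T : SetFunctor} {F : LiftingFamily T} (aut : SOAutomaton T F)
    (M : TreeModel T) (st : List (aut.St × M.S) → aut.St → Set M.S) :
    List (aut.St × M.S) → Prop
  | base : SOReach aut M st [(aut.aI, M.root)]
  | step {h : List (aut.St × M.S)} {p q : aut.St × M.S} :
      SOReach aut M st (p :: h) → q.2 ∈ st (p :: h) q.1 → SOReach aut M st (q :: p :: h)

/-- The history (most recent first) of the first `n+1` positions of a play. -/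
def histPrefix {α : Type} (f : ℕ → α) (n : ℕ) : List α :=
  ((List.range (n + 1)).map f).reverse

/-- ∃ wins an infinite match iff the maximal parity occurring infinitely often is even. -/
def SOAutomaton.WinsParity {T : SetFunctor} {F : LiftingFamily T} (aut : SOAutomaton T F)
    (M : TreeModel T) (f : ℕ → aut.St × M.S) : Prop :=
  ∃ n : ℕ, Even n ∧ (∃ᶠ i in Filter.atTop, aut.Ω (f i).1 = n) ∧
    ∀ m : ℕ, (∃ᶠ i in Filter.atTop, aut.Ω (f i).1 = m) → m ≤ n

/-- Acceptance of a `T`-tree model by a second-order automaton. -/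
def SOAutomaton.Accepts {T : SetFunctor} {F : LiftingFamily T} (aut : SOAutomaton T F)
    (M : TreeModel T) : Prop :=
  ∃ st : List (aut.St × M.S) → aut.St → Set M.S,
    (∀ (h : List (aut.St × M.S)) (a : aut.St) (s : M.S),
        SOReach aut M st ((a, s) :: h) → aut.Legal M a s (st ((a, s) :: h))) ∧
    (∀ f : ℕ → aut.St × M.S, f 0 = (aut.aI, M.root) →
        (∀ n : ℕ, (f (n + 1)).2 ∈ st (histPrefix f n) (f (n + 1)).1) →
        aut.WinsParity M f)

/-- An automaton is monotone if all its one-step sentences, regarded as generalized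
predicate liftings, are monotone. -/
def SOAutomaton.Monotone' {T : SetFunctor} {F : LiftingFamily T}
    (aut : SOAutomaton T F) : Prop :=
  ∀ (a : aut.St) (c : Set ℕ), (aut.Δ a c).toLifting.Mono

namespace SOForm

variable {T : SetFunctor} {F : LiftingFamily T}

/-- Renaming of all variables, free and bound. -/
def rename {W W' : Type} (f : W → W') : SOForm F W → SOForm F W'
  | .subset a b => .subset (f a) (f b)
  | .lift i v => .lift i (fun k => f (v k))
  | .neg φ => .neg (φ.rename f)
  | .or φ ψ => .or (φ.rename f) (ψ.rename f)
  | .ex w φ => .ex (f w) (φ.rename f)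

theorem sat_rename {W W' X : Type} {f : W → W'} (hf : Function.Injective f) (α : T.obj X)
    (φ : SOForm F W) (V : W' → Set X) :
    (φ.rename f).sat X α V ↔ φ.sat X α (V ∘ f) := by
  induction φ generalizing V with
  | subset a b => rfl
  | lift i v => rfl
  | neg φ ih => simp only [rename, sat, ih]
  | or φ ψ ih₁ ih₂ => simp only [rename, sat, ih₁, ih₂]
  | ex w φ ih =>
    have h (Z : Set X) : updW V (f w) Z ∘ f = updW (V ∘ f) w Z := by
      funext w'
      simp [updW, hf.eq_iff]
    simp only [rename, sat, ih, h]

theorem fv_rename_subset {W W' : Type} {f : W → W'} (hf : Function.Injective f)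
    (φ : SOForm F W) : (φ.rename f).fv ⊆ f '' φ.fv := by
  induction φ with
  | subset a b => simp [rename, fv, Set.image_pair]
  | lift i v => simp [rename, fv, ← Set.range_comp, Function.comp_def]
  | neg φ ih => exact ih
  | or φ ψ ih₁ ih₂ =>
    simp only [rename, fv, Set.image_union]
    exact Set.union_subset_union ih₁ ih₂
  | ex w φ ih =>
    simp only [rename, fv, Set.image_sdiff hf, Set.image_singleton]
    exact Set.sdiff_subset_sdiff_left ih

/-- Existential quantification over a list of variables. -/
def exs {W : Type} (l : List W) (φ : SOForm F W) : SOForm F W :=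
  l.foldr .ex φ

theorem sat_exs {W X : Type} (α : T.obj X) (l : List W) (φ : SOForm F W) (V : W → Set X) :
    (exs l φ).sat X α V ↔ ∃ V' : W → Set X, (∀ w ∉ l, V' w = V w) ∧ φ.sat X α V' := by
  induction l generalizing V with
  | nil =>
    refine ⟨fun h => ⟨V, fun _ _ => rfl, h⟩, ?_⟩
    rintro ⟨V', h, h'⟩
    rwa [show V' = V from funext fun w => h w List.not_mem_nil] at h'
  | cons w l ih =>
    change (∃ Z, (exs l φ).sat X α (updW V w Z)) ↔ _
    simp only [ih]
    constructor
    · rintro ⟨Z, V', h, h'⟩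
      refine ⟨V', fun w' hw' => ?_, h'⟩
      rw [List.mem_cons, not_or] at hw'
      simp [h w' hw'.2, updW, hw'.1]
    · rintro ⟨V', h, h'⟩
      refine ⟨V' w, V', fun w' hw' => ?_, h'⟩
      by_cases e : w' = w
      · simp [updW, e]
      · simp [updW, e, h w' (by simp [e, hw'])]

theorem fv_exs {W : Type} (l : List W) (φ : SOForm F W) :
    (exs l φ).fv = φ.fv \ {w | w ∈ l} := by
  induction l with
  | nil => simp [exs]
  | cons w l ih =>
    change (exs l φ).fv \ {w} = _
    rw [ih]
    ext w'
    simp only [Set.mem_sdiff, Set.mem_ofPred_eq, Set.mem_singleton_iff, List.mem_cons]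
    tauto

/-- The conjunction of `φ` with the inclusions `a ⊆ b` for the pairs `(a, b)` in a list. -/
def guard {W : Type} (l : List (W × W)) (φ : SOForm F W) : SOForm F W :=
  l.foldr (fun p ψ => .neg (.or (.neg (.subset p.1 p.2)) (.neg ψ))) φ

theorem sat_guard {W X : Type} (α : T.obj X) (l : List (W × W)) (φ : SOForm F W)
    (V : W → Set X) :
    (guard l φ).sat X α V ↔ (∀ p ∈ l, V p.1 ⊆ V p.2) ∧ φ.sat X α V := by
  induction l with
  | nil => simp [guard]
  | cons p l ih =>
    change ¬ (¬ V p.1 ⊆ V p.2 ∨ ¬ (guard l φ).sat X α V) ↔ _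
    rw [ih, List.forall_mem_cons]
    tauto

theorem mem_fv_guard {W : Type} {l : List (W × W)} {φ : SOForm F W} {w : W}
    (hw : w ∈ (guard l φ).fv) : (∃ p ∈ l, w = p.1 ∨ w = p.2) ∨ w ∈ φ.fv := by
  induction l with
  | nil => exact .inr hw
  | cons p l ih =>
    have hw : w ∈ ({p.1, p.2} : Set W) ∪ (guard l φ).fv := hw
    rcases hw with hw | hw
    · exact .inl ⟨p, List.mem_cons_self, by simpa using hw⟩
    · rcases ih hw with ⟨q, hq, h⟩ | h
      · exact .inl ⟨q, List.mem_cons_of_mem _ hq, h⟩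
      · exact .inr h

variable {A : Type} [Finite A]

variable (A) in
/-- An injective code of the variables over `A` by bound variables. -/
noncomputable def code : A ⊕ ℕ → A ⊕ ℕ :=
  Sum.inr ∘ (Countable.exists_injective_nat (A ⊕ ℕ)).choose

variable (A) in
/-- A list of all elements of a finite type. -/
noncomputable def enum : List A :=
  (@Finset.univ A (Fintype.ofFinite A)).toList

theorem mem_enum (a : A) : a ∈ enum A := by
  simp [enum]

/-- The upward closure of a one-step sentence: it asserts that `φ` holds for some valuation
below the given one. -/
noncomputable def upClosure (φ : SOForm F (A ⊕ ℕ)) : SOForm F (A ⊕ ℕ) :=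
  exs ((enum A).map fun a => code A (Sum.inl a))
    (guard ((enum A).map fun a => (code A (Sum.inl a), Sum.inl a)) (φ.rename (code A)))

theorem code_injective : Function.Injective (code A) :=
  Sum.inr_injective.comp (Countable.exists_injective_nat (A ⊕ ℕ)).choose_spec

theorem isSentence_upClosure {φ : SOForm F (A ⊕ ℕ)} (hφ : IsSentence φ) :
    IsSentence φ.upClosure := by
  intro w hw
  rw [upClosure, fv_exs] at hw
  obtain ⟨hw, hw'⟩ := hw
  have hbound (a : A) : w ≠ code A (Sum.inl a) := by
    rintro rfl
    exact hw' (List.mem_map.2 ⟨a, mem_enum a, rfl⟩)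
  rcases mem_fv_guard hw with ⟨p, hp, h⟩ | h
  · obtain ⟨a, -, rfl⟩ := List.mem_map.1 hp
    exact ⟨a, h.resolve_left (hbound a)⟩
  · obtain ⟨w', hφw, rfl⟩ := fv_rename_subset code_injective φ h
    obtain ⟨a, rfl⟩ := hφ w' hφw
    exact (hbound a rfl).elim

theorem sat0_upClosure {X : Type} (α : T.obj X) (φ : SOForm F (A ⊕ ℕ)) (V : A → Set X) :
    φ.upClosure.sat0 X α V ↔ ∃ V' : A → Set X, (∀ a, V' a ⊆ V a) ∧ φ.sat0 X α V' := by
  simp only [sat0, upClosure, sat_exs, sat_guard, sat_rename code_injective, List.mem_map,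
    mem_enum, true_and, forall_exists_index, forall_apply_eq_imp_iff, not_exists]
  constructor
  · rintro ⟨V', h, hsub, hsat⟩
    have hfix (a : A) : V' (Sum.inl a) = V a := h _ fun _ e => by simp [code] at e
    refine ⟨fun a => V' (code A (Sum.inl a)), fun a => hfix a ▸ hsub a, ?_⟩
    convert hsat using 1
    funext w
    rcases w with a | n
    · rfl
    · exact (h _ fun a e => Sum.inl_ne_inr (code_injective e)).symm
  · rintro ⟨V', hsub, hsat⟩
    let W : A ⊕ ℕ → Set X := Sum.elim V' fun _ => ∅
    have hW (w : A ⊕ ℕ) : Function.extend (code A) W (Sum.elim V fun _ => ∅) (code A w) = W w :=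
      code_injective.extend_apply _ _ _
    have hinl (a : A) :
        Function.extend (code A) W (Sum.elim V fun _ => ∅) (Sum.inl a) = V a :=
      Function.extend_apply' _ _ _ (by simp [code])
    refine ⟨Function.extend (code A) W (Sum.elim V fun _ => ∅), fun w hw => ?_, fun a => ?_, ?_⟩
    · by_cases hc : ∃ w', code A w' = w
      · obtain ⟨a | n, rfl⟩ := hc
        · exact (hw a rfl).elim
        · rw [hW]
          rfl
      · exact Function.extend_apply' _ _ _ hc
    · rw [hW, hinl]
      exact hsub a
    · rwa [show Function.extend (code A) W _ ∘ code A = W from funext hW]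

theorem upClosure_mono (φ : SOForm F (A ⊕ ℕ)) : φ.upClosure.toLifting.Mono := by
  intro X V V' h α hα
  obtain ⟨U, hU, hsat⟩ := (sat0_upClosure α φ V).1 hα
  exact (sat0_upClosure α φ V').2 ⟨U, fun a => (hU a).trans (h a), hsat⟩

end SOForm

namespace SOAutomaton

variable {T : SetFunctor} {F : LiftingFamily T}

/-- The automaton whose one-step sentences are the upward closures of those of `aut`. -/
noncomputable def upClosure (aut : SOAutomaton T F) : SOAutomaton T F :=
  haveI := aut.fin
  { aut with
    Δ := fun a c => (aut.Δ a c).upClosure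
    sentence := fun a c => SOForm.isSentence_upClosure (aut.sentence a c) }

theorem monotone_upClosure (aut : SOAutomaton T F) : aut.upClosure.Monotone' := by
  have := aut.fin
  exact fun a c => SOForm.upClosure_mono (aut.Δ a c)

theorem legal_upClosure_iff (aut : SOAutomaton T F) (M : TreeModel T) (a : aut.St) (s : M.S)
    (U : aut.St → Set M.S) :
    aut.upClosure.Legal M a s U ↔
      (∀ b, U b ⊆ {t | M.R s t}) ∧ ∃ U' : aut.St → Set M.S, (∀ b, U' b ⊆ U b) ∧
        aut.Legal M a s U' := by
  have := aut.fin
  refine and_congr_right fun hU =>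
    (SOForm.sat0_upClosure (M.σloc s) (aut.Δ a (aut.color M s)) _).trans ⟨?_, ?_⟩
  · rintro ⟨V, hV, hsat⟩
    refine ⟨fun b => Subtype.val '' V b, ?_, ?_, ?_⟩
    · rintro b _ ⟨t, ht, rfl⟩
      exact hV b ht
    · rintro b _ ⟨t, -, rfl⟩
      exact t.2
    · have hV (b : aut.St) : {t : {t' // M.R s t'} | t.1 ∈ Subtype.val '' V b} = V b :=
        Set.preimage_image_eq _ Subtype.val_injective
      simpa only [hV] using hsat
  · rintro ⟨U', hU', hL⟩
    exact ⟨_, fun b t ht => hU' b ht, hL.2⟩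

theorem accepts_upClosure_iff (aut : SOAutomaton T F) (M : TreeModel T) :
    aut.upClosure.Accepts M ↔ aut.Accepts M := by
  constructor
  · rintro ⟨st, hst, hwin⟩
    have key (h : List (aut.St × M.S)) : ∃ U : aut.St → Set M.S, (∀ b, U b ⊆ st h b) ∧
        ∀ a s l, h = (a, s) :: l → aut.upClosure.Legal M a s (st h) → aut.Legal M a s U := by
      by_cases hh : ∃ a s l, h = (a, s) :: l ∧ aut.upClosure.Legal M a s (st h)
      · obtain ⟨a, s, l, rfl, hL⟩ := hh
        obtain ⟨-, U, hU, hU'⟩ := (aut.legal_upClosure_iff M a s _).1 hL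
        refine ⟨U, hU, fun a' s' l' e _ => ?_⟩
        cases e
        exact hU'
      · exact ⟨st h, fun _ => subset_rfl, fun a s l e hL => (hh ⟨a, s, l, e, hL⟩).elim⟩
    choose st' hsub hleg using key
    have hreach (h : List (aut.St × M.S)) (hr : SOReach aut M st' h) :
        SOReach aut.upClosure M st h := by
      induction hr with
      | base => exact .base
      | step _ hq ih => exact .step ih (hsub _ _ hq)
    exact ⟨st', fun h a s hr => hleg _ a s h rfl (hst h a s (hreach _ hr)),
      fun f h0 hf => hwin f h0 fun n => hsub _ _ (hf n)⟩
  · rintro ⟨st, hst, hwin⟩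
    have hreach (h : List (aut.upClosure.St × M.S))
        (hr : SOReach aut.upClosure M st h) :
        SOReach aut M st h := by
      induction hr with
      | base => exact .base (aut := aut)
      | step _ hq ih => exact .step (aut := aut) ih hq
    refine ⟨st, fun h a s hr => ?_, hwin⟩
    have hL := hst h a s (hreach _ hr)
    exact (aut.legal_upClosure_iff M a s _).2 ⟨hL.1, _, fun _ => subset_rfl, hL⟩

end SOAutomaton

/-- Every second-order `Λ`-automaton is equivalent, over `T`-tree
models, to a monotone second-order `Λ`-automaton. -/
theorem so_automaton_monotone_equivalent (T : SetFunctor) (F : LiftingFamily T)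
    (aut : SOAutomaton T F) :
    ∃ aut' : SOAutomaton T F, aut'.P = aut.P ∧ aut'.Monotone' ∧
      ∀ M : TreeModel T, aut'.Accepts M ↔ aut.Accepts M := by
  exact ⟨aut.upClosure, rfl, aut.monotone_upClosure, aut.accepts_upClosure_iff⟩
end

section
/- (Simulation Theorem) Let T be a set functor and Λ a set of monotone predicate liftings for T. For every monotone automaton 𝔸 ∈ Aut(SO_Λ) (one in which all one-step sentences Δ(a,c) are monotone as generalized predicate liftings) there exists a non-deterministic automaton 𝔸′ ∈ Aut(SO_Λ) that accepts exactly the same T-tree models as 𝔸. -/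
open scoped Classical

/-- A generalized predicate lifting is special basic if every satisfying valuation can
be shrunk to a satisfying valuation assigning pairwise disjoint sets to the variables. -/
def GenLifting.SpecialBasic {T : SetFunctor} {A : Type} (φ : GenLifting T A) : Prop :=
  ∀ (X : Type) (α : T.obj X) (V : A → Set X), α ∈ φ.app X V →
    ∃ V' : A → Set X, (∀ a : A, V' a ⊆ V a) ∧
      (∀ a b : A, a ≠ b → V' a ∩ V' b = ∅) ∧ α ∈ φ.app X V'

/-- An automaton is non-deterministic if all its one-step sentences are special basic. -/
def SOAutomaton.NonDet {T : SetFunctor} {F : LiftingFamily T}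
    (aut : SOAutomaton T F) : Prop :=
  ∀ (a : aut.St) (c : Set ℕ), (aut.Δ a c).toLifting.SpecialBasic

/-- The parity condition on a sequence of priorities: the largest priority occurring
infinitely often is even. -/
def ParityEven (c : ℕ → ℕ) : Prop :=
  ∃ n : ℕ, Even n ∧ (∃ᶠ i in Filter.atTop, c i = n) ∧
    ∀ m : ℕ, (∃ᶠ i in Filter.atTop, c i = m) → m ≤ n

/-- `m` is the limit superior of the sequence `c` of priorities. -/
def IsMaxInf (c : ℕ → ℕ) (m : ℕ) : Prop :=
  (∃ᶠ i in Filter.atTop, c i = m) ∧ ∀ᶠ i in Filter.atTop, c i ≤ m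

theorem exists_frequently_eq {α : Type*} [Finite α] {p : ℕ → Prop}
    (hp : ∃ᶠ i in Filter.atTop, p i) (g : ℕ → α) :
    ∃ x, ∃ᶠ i in Filter.atTop, p i ∧ g i = x := by
  by_contra! h
  have h' : ∀ᶠ i in Filter.atTop, ∀ x, ¬ (p i ∧ g i = x) :=
    Filter.eventually_all.2 fun x => by
      simpa using h x
  exact hp (h'.mono fun i hi hpi => hi _ ⟨hpi, rfl⟩)

theorem exists_isMaxInf {c : ℕ → ℕ} {K : ℕ} (hc : ∀ i, c i ≤ K) : ∃ m, IsMaxInf c m := by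
  have hex : ∃ m, ∃ᶠ i in Filter.atTop, m ≤ c i :=
    ⟨0, Filter.Frequently.of_forall fun _ => Nat.zero_le _⟩
  have hb : ∀ m, (∃ᶠ i in Filter.atTop, m ≤ c i) → m ≤ K := fun m hm => by
    obtain ⟨i, hi⟩ := hm.exists
    exact hi.trans (hc i)
  set m := Nat.findGreatest (fun m => ∃ᶠ i in Filter.atTop, m ≤ c i) K with hm
  have h1 : ∃ᶠ i in Filter.atTop, m ≤ c i :=
    Nat.findGreatest_spec (P := fun m => ∃ᶠ i in Filter.atTop, m ≤ c i) (Nat.zero_le K)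
      (Filter.Frequently.of_forall fun _ => Nat.zero_le _)
  have h2 : ∀ᶠ i in Filter.atTop, c i ≤ m := by
    by_contra h
    have h3 : ∃ᶠ i in Filter.atTop, m + 1 ≤ c i := by
      refine (Filter.not_eventually.1 h).mono fun i hi => ?_
      omega
    have := Nat.le_findGreatest (P := fun m => ∃ᶠ i in Filter.atTop, m ≤ c i) (hb _ h3) h3
    omega
  exact ⟨m, (h1.and_eventually h2).mono fun i hi => le_antisymm hi.2 hi.1, h2⟩

theorem IsMaxInf.parityEven_iff {c : ℕ → ℕ} {m : ℕ} (h : IsMaxInf c m) :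
    ParityEven c ↔ Even m := by
  have hle : ∀ k, (∃ᶠ i in Filter.atTop, c i = k) → k ≤ m := fun k hk => by
    obtain ⟨i, h1, h2⟩ := (hk.and_eventually h.2).exists
    omega
  constructor
  · rintro ⟨n, hn, hf, hmax⟩
    have h1 := hle n hf
    have h2 := hmax m h.1
    rwa [show m = n by omega]
  · exact fun hm => ⟨m, hm, h.1, hle⟩

theorem parityEven_succ_iff {c : ℕ → ℕ} {K : ℕ} (hc : ∀ i, c i ≤ K) :
    ParityEven (fun i => c (i + 1)) ↔ ParityEven c := by
  obtain ⟨m, hm⟩ := exists_isMaxInf (c := fun i => c (i + 1)) fun i => hc (i + 1)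
  have h : IsMaxInf c m := by
    refine ⟨?_, ?_⟩
    · have := hm.1
      rw [← Filter.map_add_atTop_eq_nat 1, Filter.frequently_map]
      exact this
    · have := hm.2
      rw [← Filter.map_add_atTop_eq_nat 1, Filter.eventually_map]
      exact this
  rw [hm.parityEven_iff, h.parityEven_iff]

theorem exists_block {j : ℕ → ℕ} (hj : StrictMono j) (h0 : j 0 = 0) (i : ℕ) :
    ∃ n, j n ≤ i ∧ i < j (n + 1) := by
  refine ⟨Nat.findGreatest (fun n => j n ≤ i) i, ?_, ?_⟩
  · exact Nat.findGreatest_spec (P := fun n => j n ≤ i) (Nat.zero_le i) (by simp [h0])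
  · by_contra! h
    exact absurd (Nat.le_findGreatest (P := fun n => j n ≤ i) ((hj.id_le _).trans h) h)
      (Nat.not_succ_le_self _)

theorem block_unique {j : ℕ → ℕ} (hj : StrictMono j) {i n n' : ℕ} (h1 : j n ≤ i)
    (h2 : i < j (n + 1)) (h1' : j n' ≤ i) (h2' : i < j (n' + 1)) : n = n' := by
  have a := hj.lt_iff_lt.1 (h1.trans_lt h2')
  have b := hj.lt_iff_lt.1 (h1'.trans_lt h2)
  omega

/-- Taking maxima over consecutive blocks preserves the parity condition. -/
theorem parityEven_block_iff {c : ℕ → ℕ} {K : ℕ} (hc : ∀ i, c i ≤ K) {j : ℕ → ℕ}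
    (hj : StrictMono j) (h0 : j 0 = 0) :
    ParityEven (fun n => (Finset.Ico (j n) (j (n + 1))).sup c) ↔ ParityEven c := by
  obtain ⟨m, hm⟩ := exists_isMaxInf hc
  obtain ⟨I, hI⟩ := Filter.eventually_atTop.1 hm.2
  have hle : ∀ n ≥ I, (Finset.Ico (j n) (j (n + 1))).sup c ≤ m := fun n hn =>
    Finset.sup_le fun i hi => hI i (hn.trans ((hj.id_le n).trans (Finset.mem_Ico.1 hi).1))
  have h : IsMaxInf (fun n => (Finset.Ico (j n) (j (n + 1))).sup c) m := by
    refine ⟨Filter.frequently_atTop.2 fun N => ?_, Filter.eventually_atTop.2 ⟨I, hle⟩⟩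
    obtain ⟨i, hi, him⟩ := Filter.frequently_atTop.1 hm.1 (j (max N I))
    obtain ⟨n, h1, h2⟩ := exists_block hj h0 i
    have h3 := hj.lt_iff_lt.1 (hi.trans_lt h2)
    refine ⟨n, by omega, le_antisymm (hle n (by omega)) ?_⟩
    rw [← him]
    exact Finset.le_sup (Finset.mem_Ico.2 ⟨h1, h2⟩)
  rw [hm.parityEven_iff, h.parityEven_iff]

section Positional

variable {α : Type} (st : List α → Set α) (v₀ : α)

/-- Histories reachable from `v₀` when the successors of a history `h` are those in `st h`. -/
inductive HistReach : List α → Prop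
  | base : HistReach [v₀]
  | step {h : List α} {p q : α} : HistReach (p :: h) → q ∈ st (p :: h) →
      HistReach (q :: p :: h)

theorem histPrefix_succ {α : Type} (f : ℕ → α) (n : ℕ) :
    histPrefix f (n + 1) = f (n + 1) :: histPrefix f n := by
  simp [histPrefix, List.range_succ]

theorem histPrefix_zero {α : Type} (f : ℕ → α) : histPrefix f 0 = [f 0] := by
  simp [histPrefix]

theorem length_histPrefix {α : Type} (f : ℕ → α) (n : ℕ) : (histPrefix f n).length = n + 1 := by
  simp [histPrefix]

variable {st v₀}

theorem HistReach.of_append {l h : List α} {p : α} (hr : HistReach st v₀ (l ++ p :: h)) :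
    HistReach st v₀ (p :: h) := by
  induction l with
  | nil => exact hr
  | cons a l ih =>
    apply ih
    cases l with
    | nil => cases hr with | step h1 _ => exact h1
    | cons b l => cases hr with | step h1 _ => exact h1

theorem HistReach.append_singleton {l : List α} {p : α} (hr : HistReach st v₀ (l ++ [p])) :
    p = v₀ := by
  have := hr.of_append
  cases this
  rfl

variable (st v₀)

/-- The history `h'` is a reachable extension of `h` by positions of priority at most `k`,
one of which has priority exactly `k`. -/
def ExtVia (c : α → ℕ) (k : ℕ) (h' h : List α) : Prop :=
  HistReach st v₀ h' ∧ h ≠ [] ∧ ∃ l, h' = l ++ h ∧ (∀ x ∈ l, c x ≤ k) ∧ ∃ x ∈ l, c x = k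

theorem exists_limit_of_suffix_chain {g : ℕ → List α} (hg : ∀ n, g n <:+ g (n + 1))
    (hl : ∀ n, n < (g n).length) :
    ∃ f : ℕ → α, ∀ n, (g n).reverse = (List.range (g n).length).map f := by
  have hmono : ∀ m n, m ≤ n → g m <:+ g n := fun m n h =>
    Nat.le_induction (List.suffix_refl _) (fun k _ ih => ih.trans (hg k)) n h
  refine ⟨fun i => (g i).reverse[i]'(by simpa using hl i), fun n => ?_⟩
  apply List.ext_getElem
  · simp
  intro i h1 h2
  simp only [List.getElem_map, List.getElem_range]
  rcases le_total i n with h | h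
  · exact ((List.reverse_prefix.2 (hmono i n h)).getElem (by simpa using hl i)).symm
  · exact (List.reverse_prefix.2 (hmono n i h)).getElem h1

theorem wellFounded_extVia {c : α → ℕ} {k : ℕ} (hk : ¬ Even k)
    (hst : ∀ f : ℕ → α, f 0 = v₀ → (∀ n, f (n + 1) ∈ st (histPrefix f n)) →
      ParityEven fun i => c (f i)) :
    WellFounded (ExtVia st v₀ c k) := by
  rw [wellFounded_iff_isEmpty_descending_chain]
  refine ⟨fun ⟨g, hg⟩ => ?_⟩
  have hsuf : ∀ n, g n <:+ g (n + 1) := fun n => by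
    obtain ⟨_, _, l, h, _⟩ := hg n
    exact ⟨l, h.symm⟩
  have hlen : ∀ n, n < (g n).length := fun n => by
    induction n with
    | zero => exact List.length_pos_iff.2 (hg 0).2.1
    | succ n ih =>
      obtain ⟨_, _, l, h, _, x, hx, _⟩ := hg n
      have := List.length_pos_of_mem hx
      rw [h, List.length_append]
      omega
  obtain ⟨f, hf⟩ := exists_limit_of_suffix_chain hsuf hlen
  have hg' : ∀ n, g n = ((List.range (g n).length).map f).reverse := fun n => by
    rw [← hf n, List.reverse_reverse]
  have hreach : ∀ n, HistReach st v₀ (histPrefix f n) := fun n => by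
    have h1 : HistReach st v₀ (g (n + 1)) := (hg n).1
    rw [hg'] at h1
    have h2 : n + 1 ≤ (g (n + 1)).length := (hlen (n + 1)).le
    obtain ⟨d, hd⟩ := Nat.exists_eq_add_of_le h2
    rw [hd, List.range_add, List.map_append, List.reverse_append] at h1
    change HistReach st v₀ (_ ++ histPrefix f n) at h1
    cases n with
    | zero =>
      rw [histPrefix_zero] at h1 ⊢
      exact h1.of_append
    | succ n =>
      rw [histPrefix_succ] at h1 ⊢
      exact h1.of_append
  have hpar : ParityEven fun i => c (f i) := by
    refine hst f ?_ fun n => ?_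
    · have := hreach 0
      rw [histPrefix_zero] at this
      exact HistReach.append_singleton (l := []) this
    · have := hreach (n + 1)
      rw [histPrefix_succ] at this
      generalize hh : histPrefix f n = h at this
      cases this with
      | base => simpa [hh] using length_histPrefix f n
      | step _ h2 => exact h2
  have hget : ∀ n l l', g n = l ++ l' → ∀ i, l'.length ≤ i → i < (g n).length → f i ∈ l := by
    intro n l l' h i h1 h2
    have h3 := hf n
    have h4 : (g n).reverse[i]'(by simpa using h2) = f i := by
      simp [h3]
    rw [← h4]
    simp only [h, List.reverse_append]
    rw [List.getElem_append_right (by simpa using h1)]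
    exact List.mem_reverse.1 (List.getElem_mem _)
  have hall : ∀ n, ∃ l, g n = l ++ g 0 ∧ ∀ x ∈ l, c x ≤ k := fun n => by
    induction n with
    | zero => exact ⟨[], rfl, by simp⟩
    | succ n ih =>
      obtain ⟨l, hl, hl'⟩ := ih
      obtain ⟨_, _, m, hm, hm', _⟩ := hg n
      refine ⟨m ++ l, by rw [hm, hl, List.append_assoc], fun x hx => ?_⟩
      rcases List.mem_append.1 hx with h | h
      exacts [hm' x h, hl' x h]
  have hmax : IsMaxInf (fun i => c (f i)) k := by
    refine ⟨Filter.frequently_atTop.2 fun n => ?_,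
      Filter.eventually_atTop.2 ⟨(g 0).length, fun i hi => ?_⟩⟩
    · obtain ⟨_, _, l, hl, _, x, hx, hxk⟩ := hg n
      obtain ⟨i, hi, rfl⟩ := List.getElem_of_mem (List.mem_reverse.2 hx)
      have h3 := hf (n + 1)
      rw [hl, List.reverse_append] at h3
      refine ⟨(g n).length + i, by have := hlen n; omega, ?_⟩
      rw [← hxk]
      have h4 : ((g n).reverse ++ l.reverse)[(g n).length + i]'(by simpa using hi) =
          f ((g n).length + i) := by simp [h3]
      change c (f _) = _
      rw [← h4, List.getElem_append_right (by simp)]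
      simp
    · obtain ⟨l, hl, hl'⟩ := hall i
      exact hl' _ (hget i l _ hl i hi (hlen i))
  exact hk (hmax.parityEven_iff.1 hpar)

/-- Erasing the coordinates below `k` of a priority-indexed tuple of ordinals. -/
def truncSig {N : ℕ} (k : ℕ) (x : Colex (Fin N → Ordinal.{0})) :
    Colex (Fin N → Ordinal.{0}) :=
  toColex fun j => if k ≤ j then ofColex x j else 0

theorem truncSig_mono {N : ℕ} (k : ℕ) : Monotone (truncSig (N := N) k) := by
  intro x y h
  rcases h.eq_or_lt with rfl | h
  · exact le_rfl
  obtain ⟨i, h1, h2⟩ := h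
  by_cases hk : k ≤ i
  · refine le_of_lt ⟨i, fun j hj => ?_, ?_⟩
    · change (if k ≤ j then x j else 0) = if k ≤ j then y j else 0
      rw [show x j = y j from h1 j hj]
    · change (if k ≤ i then x i else 0) < if k ≤ i then y i else 0
      simpa only [if_pos hk] using h2
  · refine le_of_eq (funext fun j => ?_)
    change (if k ≤ j then x j else 0) = if k ≤ j then y j else 0
    by_cases hj : k ≤ j
    · rw [show x j = y j from h1 j (lt_of_not_ge fun h => hk (hj.trans (by exact_mod_cast h)))]
    · simp only [if_neg hj]

theorem truncSig_le {N k : ℕ} {x y : Fin N → Ordinal.{0}}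
    (h : ∀ j : Fin N, k ≤ j → x j ≤ y j) :
    truncSig k (toColex x) ≤ truncSig k (toColex y) := by
  refine Pi.toColex_monotone fun j => ?_
  by_cases hj : k ≤ j
  · simpa [hj] using h j hj
  · simp [hj]

theorem truncSig_lt {N : ℕ} {k : Fin N} {x y : Fin N → Ordinal.{0}}
    (h : ∀ j : Fin N, (k : ℕ) ≤ j → x j ≤ y j) (hk : x k < y k) :
    truncSig k (toColex x) < truncSig k (toColex y) := by
  refine Pi.toColex_strictMono (Pi.lt_def.2 ⟨fun j => ?_, k, by simpa using hk⟩)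
  by_cases hj : k ≤ j
  · simpa [hj] using h j (by exact_mod_cast hj)
  · simp [hj]

theorem not_frequently_lt_of_eventually_antitone {β : Type*} [LinearOrder β] [WellFoundedLT β]
    {g : ℕ → β} {I : ℕ} (h : ∀ i ≥ I, g (i + 1) ≤ g i) :
    ¬ ∃ᶠ i in Filter.atTop, g (i + 1) < g i := by
  intro hf
  obtain ⟨m, ⟨hm, hmin⟩⟩ : ∃ m, m ≥ I ∧ ∀ n ≥ I, g m ≤ g n := by
    have hne : (g '' Set.Ici I).Nonempty := ⟨_, I, le_refl I, rfl⟩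
    obtain ⟨m, hm, he⟩ := wellFounded_lt.min_mem (g '' Set.Ici I) hne
    refine ⟨m, hm, fun n hn => ?_⟩
    rw [he]
    exact le_of_not_gt (wellFounded_lt.not_lt_min (g '' Set.Ici I) ⟨n, hn, rfl⟩)
  have hle : ∀ n, m ≤ n → g n ≤ g m := fun n hn =>
    Nat.le_induction le_rfl (fun k hk ih => (h k (hm.trans hk)).trans ih) n hn
  obtain ⟨i, hi, hlt⟩ := Filter.frequently_atTop.1 hf m
  exact absurd (hlt.trans_le (hle i hi)) (not_lt.2 (hmin (i + 1) (by omega)))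

instance {N : ℕ} : @WellFoundedLT (Colex (Fin N → Ordinal.{0}))
    (Pi.Colex.linearOrder.toPartialOrder.toPreorder.toLT) :=
  Pi.Colex.wellFoundedLT

/-- Positional determinacy for the player who has the winning strategy `st`: from every
reachable position one can play as after one fixed history leading to that position. -/
theorem exists_positional {c : α → ℕ} {K : ℕ} (hc : ∀ v, c v ≤ K)
    (hst : ∀ f : ℕ → α, f 0 = v₀ → (∀ n, f (n + 1) ∈ st (histPrefix f n)) →
      ParityEven fun i => c (f i)) :
    ∃ H : α → List α,
      (∀ v h, HistReach st v₀ (v :: h) → HistReach st v₀ (v :: H v)) ∧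
      ∀ f : ℕ → α, HistReach st v₀ (f 0 :: H (f 0)) →
        (∀ n, f (n + 1) ∈ st (f n :: H (f n))) → ParityEven fun i => c (f i) := by
  let r : ℕ → List α → Ordinal.{0} := fun k h =>
    if hk : ¬ Even k then ((wellFounded_extVia st v₀ hk hst).apply h).rank else 0
  let sig : List α → Fin (K + 1) → Ordinal.{0} := fun h k => r k h
  have hchoice : ∀ v, ∃ h₀, (∀ h, HistReach st v₀ (v :: h) → HistReach st v₀ (v :: h₀) ∧
      toColex (sig (v :: h₀)) ≤ toColex (sig (v :: h))) := fun v => by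
    by_cases hv : ∃ h, HistReach st v₀ (v :: h)
    · have hne : ((fun h => toColex (sig (v :: h))) '' {h | HistReach st v₀ (v :: h)}).Nonempty :=
        Set.Nonempty.image _ hv
      obtain ⟨h₀, hh, he⟩ := wellFounded_lt.min_mem _ hne
      refine ⟨h₀, fun h hr => ⟨hh, ?_⟩⟩
      change (fun h => toColex (sig (v :: h))) h₀ ≤ _
      rw [he]
      exact le_of_not_gt (wellFounded_lt.not_lt_min
        ((fun h => toColex (sig (v :: h))) '' {h | HistReach st v₀ (v :: h)}) ⟨h, hr, rfl⟩)
    · push Not at hv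
      exact ⟨[], fun h hr => absurd hr (hv h)⟩
  choose H hH using hchoice
  refine ⟨H, fun v h hr => (hH v h hr).1, fun f h0 hf => ?_⟩
  have hreach : ∀ n, HistReach st v₀ (f n :: H (f n)) := fun n => by
    induction n with
    | zero => exact h0
    | succ n ih => exact (hH _ _ (ih.step (hf n))).1
  have hstep : ∀ n, HistReach st v₀ (f (n + 1) :: f n :: H (f n)) := fun n =>
    (hreach n).step (hf n)
  have hr_le : ∀ n k, c (f (n + 1)) ≤ k →
      r k (f (n + 1) :: f n :: H (f n)) ≤ r k (f n :: H (f n)) := fun n k hk => by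
    by_cases hp : ¬ Even k
    · simp only [r, dif_pos hp]
      rw [Acc.rank_eq, Acc.rank_eq]
      refine Ordinal.iSup_le fun ⟨h', h1, _, l, h2, h3, h4⟩ => ?_
      refine Ordinal.le_iSup (fun b : { b // ExtVia st v₀ c k b (f n :: H (f n)) } =>
        Order.succ ((wellFounded_extVia st v₀ hp hst).apply b.1).rank)
        ⟨h', h1, by simp, l ++ [f (n + 1)], by simp [h2], ?_, ?_⟩
      · intro x hx
        rcases List.mem_append.1 hx with h | h
        · exact h3 x h
        · rwa [List.mem_singleton.1 h]
      · obtain ⟨x, hx, hxk⟩ := h4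
        exact ⟨x, List.mem_append_left _ hx, hxk⟩
    · simp only [r, dif_neg hp]
      exact le_rfl
  have hr_lt : ∀ n, ¬ Even (c (f (n + 1))) →
      r (c (f (n + 1))) (f (n + 1) :: f n :: H (f n)) < r (c (f (n + 1))) (f n :: H (f n)) :=
    fun n hp => by
      simp only [r, dif_pos hp]
      exact Acc.rank_lt_of_rel ((wellFounded_extVia st v₀ hp hst).apply _)
        ⟨hstep n, by simp, [f (n + 1)], rfl, by simp, by simp⟩
  obtain ⟨m, hm⟩ := exists_isMaxInf (c := fun i => c (f i)) fun i => hc (f i)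
  rw [hm.parityEven_iff]
  by_contra hodd
  obtain ⟨I, hI⟩ := Filter.eventually_atTop.1 hm.2
  have hmK : m ≤ K := by
    obtain ⟨i, hi⟩ := hm.1.exists
    exact hi ▸ hc (f i)
  let g : ℕ → Colex (Fin (K + 1) → Ordinal.{0}) := fun i =>
    truncSig m (toColex (sig (f i :: H (f i))))
  have hmin : ∀ n, g (n + 1) ≤ truncSig m (toColex (sig (f (n + 1) :: f n :: H (f n)))) :=
    fun n => truncSig_mono m (hH _ _ (hstep n)).2
  have hanti : ∀ i ≥ I, g (i + 1) ≤ g i := fun i hi =>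
    (hmin i).trans (truncSig_le fun j hj => hr_le i j ((hI (i + 1) (by omega)).trans hj))
  refine not_frequently_lt_of_eventually_antitone hanti (Filter.frequently_atTop.2 fun N => ?_)
  obtain ⟨i, hi, him⟩ := Filter.frequently_atTop.1 hm.1 (N + 1)
  obtain ⟨i, rfl⟩ : ∃ i', i = i' + 1 := ⟨i - 1, by omega⟩
  refine ⟨i, by omega, (hmin i).trans_lt ?_⟩
  simp only at him
  refine truncSig_lt (k := ⟨m, by omega⟩) (fun j hj => hr_le i j ?_) ?_
  · rw [him]; exact hj
  · have := hr_lt i (him ▸ hodd)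
    rw [him] at this
    exact this

end Positional

section Factorization

variable {S : Type} [Monoid S]

/-- The product of the letters of `w` at the positions `i, …, j - 1`. -/
def wprod (w : ℕ → S) (i : ℕ) : ℕ → S
  | 0 => 1
  | j + 1 => if i ≤ j then wprod w i j * w j else 1

theorem wprod_self (w : ℕ → S) (i : ℕ) : wprod w i i = 1 := by
  cases i <;> simp [wprod]

theorem wprod_succ (w : ℕ → S) {i j : ℕ} (h : i ≤ j) :
    wprod w i (j + 1) = wprod w i j * w j := by
  simp [wprod, h]

theorem wprod_mul (w : ℕ → S) {i j k : ℕ} (hij : i ≤ j) (hjk : j ≤ k) :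
    wprod w i j * wprod w j k = wprod w i k := by
  induction k, hjk using Nat.le_induction with
  | base => rw [wprod_self, mul_one]
  | succ k hk ih => rw [wprod_succ w hk, wprod_succ w (hij.trans hk), ← mul_assoc, ih]

/-- The suffix of `l` starting at `a` has the same product as some later nonempty suffix. -/
def SufDup (l : List S) (a : ℕ) : Prop :=
  ∃ b, a < b ∧ b < l.length ∧ (l.drop a).prod = (l.drop b).prod

/-- The first position at which a suffix with a duplicated product starts. -/
noncomputable def leader {l : List S} (h : ∃ a, SufDup l a) : ℕ := Nat.find h

/-- A position starting a later suffix with the same product as that of the leader. -/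
noncomputable def partner {l : List S} (h : ∃ a, SufDup l a) : ℕ := (Nat.find_spec h).choose

theorem leader_lt_partner {l : List S} (h : ∃ a, SufDup l a) : leader h < partner h :=
  (Nat.find_spec h).choose_spec.1

theorem partner_lt {l : List S} (h : ∃ a, SufDup l a) : partner h < l.length :=
  (Nat.find_spec h).choose_spec.2.1

theorem prod_drop_leader {l : List S} (h : ∃ a, SufDup l a) :
    (l.drop (leader h)).prod = (l.drop (partner h)).prod :=
  (Nat.find_spec h).choose_spec.2.2

/-- Merge all factors from the leader onwards, if two suffixes have the same product. -/
noncomputable def collapse (l : List S) : List S :=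
  if h : ∃ a, SufDup l a then l.take (leader h) ++ [(l.drop (leader h)).prod] else l

/-- The priority emitted when `l` is collapsed. -/
noncomputable def collapsePrio (good : S → S → Prop) (N : ℕ) (l : List S) : ℕ :=
  if h : ∃ a, SufDup l a then
    2 * (N - leader h) +
      if good (l.take (partner h)).prod ((l.take (partner h)).drop (leader h)).prod then 0 else 1
  else 0

theorem not_sufDup_collapse (l : List S) (a : ℕ) : ¬ SufDup (collapse l) a := by
  unfold collapse
  split_ifs with h
  · have hl : leader h ≤ l.length := ((leader_lt_partner h).trans (partner_lt h)).le
    have hd : ∀ c ≤ leader h,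
        ((l.take (leader h) ++ [(l.drop (leader h)).prod]).drop c).prod = (l.drop c).prod := by
      intro c hc
      rw [List.drop_append_of_le_length (by simp; omega), List.prod_append, List.prod_singleton,
        ← List.prod_append]
      congr 1
      conv_rhs => rw [← List.take_append_drop (leader h) l]
      rw [List.drop_append_of_le_length (by simp; omega)]
    rintro ⟨b, hab, hb, he⟩
    simp only [List.length_append, List.length_take, List.length_singleton] at hb
    rw [hd a (by omega), hd b (by omega)] at he
    have hlt : a < leader h := by omega
    exact Nat.find_min h hlt
      ⟨b, hab, by have := leader_lt_partner h; have := partner_lt h; omega, he⟩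
  · exact fun h' => h ⟨a, h'⟩

theorem length_le_card_of_not_sufDup [Finite S] {l : List S} (h : ∀ a, ¬ SufDup l a) :
    l.length ≤ Nat.card S := by
  have hinj : Function.Injective fun a : Fin l.length => (l.drop a).prod := by
    intro a b hab
    rcases lt_trichotomy a b with hlt | rfl | hlt
    · exact absurd ⟨b, hlt, b.2, hab⟩ (h a)
    · rfl
    · exact absurd ⟨a, hlt, a.2, hab.symm⟩ (h b)
  simpa using Nat.card_le_card_of_injective _ hinj

/-- `l` lists the products of the factors of `w` cut at the positions
`0 = P 0 < P 1 < … < P l.length = n`. -/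
structure Tracks (w : ℕ → S) (l : List S) (P : ℕ → ℕ) (n : ℕ) : Prop where
  zero : P 0 = 0
  last : P l.length = n
  lt : ∀ a < l.length, P a < P (a + 1)
  get : ∀ (a : ℕ) (h : a < l.length), l[a] = wprod w (P a) (P (a + 1))

namespace Tracks

variable {w : ℕ → S} {l : List S} {P : ℕ → ℕ} {n : ℕ}

theorem mono (h : Tracks w l P n) {a b : ℕ} (hab : a ≤ b) (hb : b ≤ l.length) : P a ≤ P b := by
  induction b, hab using Nat.le_induction with
  | base => exact le_rfl
  | succ b _ ih => exact (ih (by omega)).trans (h.lt b (by omega)).le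

theorem strictMono (h : Tracks w l P n) {a b : ℕ} (hab : a < b) (hb : b ≤ l.length) :
    P a < P b :=
  (h.lt a (by omega)).trans_le (h.mono hab hb)

theorem prod_segment (h : Tracks w l P n) {a b : ℕ} (hab : a ≤ b) (hb : b ≤ l.length) :
    ((l.take b).drop a).prod = wprod w (P a) (P b) := by
  induction b, hab using Nat.le_induction with
  | base => simp [wprod_self]
  | succ b hab' ih =>
    rw [List.take_succ_eq_append_getElem (by omega),
      List.drop_append_of_le_length (by simp; omega), List.prod_append, ih (by omega),
      List.prod_singleton, h.get b (by omega),
      wprod_mul w (h.mono hab' (by omega)) (h.lt b (by omega)).le]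

theorem prod_drop (h : Tracks w l P n) {a : ℕ} (ha : a ≤ l.length) :
    (l.drop a).prod = wprod w (P a) n := by
  have := h.prod_segment ha le_rfl
  rwa [List.take_length, h.last] at this

theorem prod_take (h : Tracks w l P n) {a : ℕ} (ha : a ≤ l.length) :
    (l.take a).prod = wprod w 0 (P a) := by
  have := h.prod_segment (Nat.zero_le a) ha
  rwa [List.drop_zero, h.zero] at this

theorem append (h : Tracks w l P n) :
    Tracks w (l ++ [w n]) (Function.update P (l.length + 1) (n + 1)) (n + 1) where
  zero := by simp [h.zero]
  last := by simp
  lt a ha := by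
    simp only [List.length_append, List.length_singleton] at ha
    rw [Function.update_of_ne (by omega)]
    rcases Nat.lt_succ_iff_lt_or_eq.1 ha with h1 | rfl
    · rw [Function.update_of_ne (by omega)]
      exact h.lt a h1
    · rw [Function.update_self, h.last]
      exact Nat.lt_succ_self n
  get a ha := by
    simp only [List.length_append, List.length_singleton] at ha
    rw [Function.update_of_ne (by omega)]
    rcases Nat.lt_succ_iff_lt_or_eq.1 ha with h1 | rfl
    · rw [Function.update_of_ne (by omega), List.getElem_append_left h1]
      exact h.get a h1
    · rw [Function.update_self, h.last, wprod_succ w le_rfl, wprod_self, one_mul]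
      simp

theorem merge (h : Tracks w l P n) {a : ℕ} (ha : a < l.length) {P' : ℕ → ℕ}
    (hP : ∀ b ≤ a, P' b = P b) (hn : P' (a + 1) = n) :
    Tracks w (l.take a ++ [(l.drop a).prod]) P' n := by
  have hlen : (l.take a ++ [(l.drop a).prod]).length = a + 1 := by simp; omega
  refine ⟨by rw [hP 0 (by omega), h.zero], by rw [hlen, hn], fun b hb => ?_, fun b hb => ?_⟩
  · rw [hlen] at hb
    rw [hP b (by omega)]
    rcases Nat.lt_succ_iff_lt_or_eq.1 hb with h1 | rfl
    · rw [hP (b + 1) (by omega)]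
      exact h.lt b (by omega)
    · rw [hn, ← h.last]
      exact h.strictMono ha le_rfl
  · have hb' : b < a + 1 := hlen ▸ hb
    rw [hP b (by omega)]
    rcases Nat.lt_succ_iff_lt_or_eq.1 hb' with h1 | rfl
    · rw [hP (b + 1) (by omega), List.getElem_append_left (by simp; omega), List.getElem_take]
      exact h.get b (by omega)
    · rw [hn, List.getElem_append_right (by simp), ← h.prod_drop ha.le]
      simp

end Tracks

/-- The start positions of the factors maintained along a run `l`. -/
noncomputable def cutPos (l : ℕ → List S) : ℕ → ℕ → ℕ
  | 0 => fun _ => 0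
  | n + 1 => Function.update (cutPos l n) (l (n + 1)).length (n + 1)

variable {w : ℕ → S} {l : ℕ → List S}

theorem length_collapse_of_sufDup {l : List S} (h : ∃ a, SufDup l a) :
    (collapse l).length = leader h + 1 := by
  have := leader_lt_partner h
  have := partner_lt h
  simp [collapse, h]
  omega

theorem collapse_of_not_sufDup {l : List S} (h : ¬ ∃ a, SufDup l a) : collapse l = l := by
  simp only [collapse, dif_neg h]

theorem tracks_cutPos (h0 : l 0 = []) (hs : ∀ n, l (n + 1) = collapse (l n ++ [w n])) (n : ℕ) :
    Tracks w (l n) (cutPos l n) n := by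
  induction n with
  | zero =>
    rw [h0]
    exact ⟨rfl, rfl, by simp, by simp⟩
  | succ n ih =>
    simp only [cutPos]
    have hap := ih.append
    by_cases h : ∃ a, SufDup (l n ++ [w n]) a
    · have h1 := leader_lt_partner h
      have h2 := partner_lt h
      rw [hs n, length_collapse_of_sufDup h]
      simp only [collapse, dif_pos h]
      refine hap.merge (by omega) (fun b hb => ?_) (by simp)
      simp only [List.length_append, List.length_singleton] at h2
      rw [Function.update_of_ne (by omega), Function.update_of_ne (by omega)]
    · rw [hs n, collapse_of_not_sufDup h]
      simpa using hap

theorem length_run_le [Finite S] (h0 : l 0 = [])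
    (hs : ∀ n, l (n + 1) = collapse (l n ++ [w n])) (n : ℕ) : (l n).length ≤ Nat.card S := by
  cases n with
  | zero => simp [h0]
  | succ n =>
    rw [hs]
    exact length_le_card_of_not_sufDup (not_sufDup_collapse _)

theorem frequently_sufDup [Finite S] (h0 : l 0 = [])
    (hs : ∀ n, l (n + 1) = collapse (l n ++ [w n])) :
    ∃ᶠ n in Filter.atTop, ∃ a, SufDup (l n ++ [w n]) a := by
  intro hev
  obtain ⟨I, hI⟩ := Filter.eventually_atTop.1 hev
  have hgrow : ∀ d, d ≤ (l (I + d)).length := fun d => by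
    induction d with
    | zero => exact Nat.zero_le _
    | succ d ih =>
      rw [← add_assoc, hs, collapse_of_not_sufDup (hI _ (by omega))]
      simpa using ih
  have := hgrow (Nat.card S + 1)
  have := length_run_le h0 hs (I + (Nat.card S + 1))
  omega

theorem collapsePrio_le (good : S → S → Prop) (N : ℕ) (l : List S) :
    collapsePrio good N l ≤ 2 * N + 1 := by
  unfold collapsePrio
  split_ifs <;> omega

/-- The priorities emitted along the run on `w` decide whether `good` holds of some ultimately
periodic Ramsey factorization of `w`. -/
theorem exists_ramsey_factorization [Finite S] (good : S → S → Prop) (h0 : l 0 = [])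
    (hs : ∀ n, l (n + 1) = collapse (l n ++ [w n])) :
    ∃ (j : ℕ → ℕ) (x f : S), StrictMono j ∧ 0 < j 0 ∧ wprod w 0 (j 0) = x ∧
      (∀ n, wprod w (j n) (j (n + 1)) = f) ∧
      (ParityEven (fun n => collapsePrio good (Nat.card S + 1) (l n ++ [w n])) ↔ good x f) := by
  set N := Nat.card S + 1 with hN
  set c : ℕ → ℕ := fun n => collapsePrio good N (l n ++ [w n]) with hc
  have htr := tracks_cutPos h0 hs
  obtain ⟨m, hm⟩ := exists_isMaxInf (c := c) (K := 2 * N + 1) fun n => collapsePrio_le _ _ _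
  have hlead : ∀ n (h : ∃ a, SufDup (l n ++ [w n]) a), leader h < N := fun n h => by
    have h1 := leader_lt_partner h
    have h2 := partner_lt h
    have h3 := length_run_le h0 hs n
    simp only [List.length_append, List.length_singleton] at h2
    omega
  have hc_dup : ∀ n (h : ∃ a, SufDup (l n ++ [w n]) a), c n = 2 * (N - leader h) +
      if good ((l n ++ [w n]).take (partner h)).prod
        (((l n ++ [w n]).take (partner h)).drop (leader h)).prod then 0 else 1 := fun n h => by
    simp only [hc, collapsePrio, dif_pos h]
  obtain ⟨I, hI⟩ := Filter.eventually_atTop.1 hm.2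
  have hm2 : 2 ≤ m := by
    obtain ⟨n, hn, h⟩ := Filter.frequently_atTop.1 (frequently_sufDup h0 hs) I
    have h1 := hI n hn
    have h2 := hlead n h
    rw [hc_dup n h] at h1
    omega
  have hdup_of : ∀ n, c n = m → ∃ a, SufDup (l n ++ [w n]) a := fun n hn => by
    by_contra h
    simp only [hc, collapsePrio, dif_neg h] at hn
    omega
  obtain ⟨p, hp⟩ : ∃ p, ∀ n (_ : c n = m) (h : ∃ a, SufDup (l n ++ [w n]) a), leader h = p := by
    refine ⟨N - m / 2, fun n hn h => ?_⟩
    have h1 := hlead n h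
    rw [hc_dup n h] at hn
    split_ifs at hn <;> omega
  have hp_le : ∀ n ≥ I, ∀ h : (∃ a, SufDup (l n ++ [w n]) a), p ≤ leader h := fun n hn h => by
    obtain ⟨n', hn'⟩ := hm.1.exists
    have h1 := hI n hn
    have h2 := hlead n h
    have h3 := hlead n' (hdup_of n' hn')
    have h4 := hp n' hn' (hdup_of n' hn')
    rw [hc_dup n h] at h1
    rw [← hn', hc_dup n' (hdup_of n' hn'), h4] at h1
    split_ifs at h1 <;> omega
  obtain ⟨n₀, hn₀, hn₀m⟩ := Filter.frequently_atTop.1 hm.1 I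
  have hlen : ∀ n > n₀, p < (l n).length := fun n hn => by
    induction n, hn using Nat.le_induction with
    | base =>
      rw [hs, length_collapse_of_sufDup (hdup_of n₀ hn₀m), hp n₀ hn₀m]
      exact Nat.lt_succ_self p
    | succ n hn ih =>
      rw [hs]
      by_cases h : ∃ a, SufDup (l n ++ [w n]) a
      · rw [length_collapse_of_sufDup h]
        exact Nat.lt_succ_of_le (hp_le n (by omega) h)
      · rw [collapse_of_not_sufDup h, List.length_append]
        omega
  have hstable : ∀ n > n₀, cutPos l n p = cutPos l (n₀ + 1) p := fun n hn => by
    induction n, hn using Nat.le_induction with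
    | base => rfl
    | succ n hn ih =>
      simp only [cutPos] at ih ⊢
      rw [Function.update_of_ne (hlen (n + 1) (by omega)).ne, ih]
  have hnext : ∀ n > n₀, c n = m → ∀ n' > n, n + 1 ≤ cutPos l n' (p + 1) := fun n hn hnm n' hn' => by
    induction n', hn' using Nat.le_induction with
    | base =>
      have h1 : (l (n + 1)).length = p + 1 := by
        rw [hs, length_collapse_of_sufDup (hdup_of n hnm), hp n hnm]
      simp [cutPos, h1]
    | succ n' hn' ih =>
      simp only [cutPos]
      by_cases h : p + 1 = (l (n' + 1)).length
      · rw [h, Function.update_self]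
        omega
      · rw [Function.update_of_ne h]
        exact ih
  let xf : ℕ → S × S := fun n =>
    if h : ∃ a, SufDup (l n ++ [w n]) a then (((l n ++ [w n]).take (partner h)).prod,
      (((l n ++ [w n]).take (partner h)).drop (leader h)).prod) else (1, 1)
  obtain ⟨⟨x, f⟩, hxf⟩ := exists_frequently_eq hm.1 xf
  obtain ⟨φ, hφ, hφ'⟩ := Filter.extraction_of_frequently_atTop
    (hxf.and_eventually (Filter.eventually_gt_atTop n₀))
  have hdup : ∀ k, ∃ a, SufDup (l (φ k) ++ [w (φ k)]) a := fun k => hdup_of _ (hφ' k).1.1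
  have hld : ∀ k, leader (hdup k) = p := fun k => hp _ (hφ' k).1.1 _
  have hpl : ∀ k, p < partner (hdup k) := fun k => hld k ▸ leader_lt_partner (hdup k)
  have hpr : ∀ k, partner (hdup k) ≤ (l (φ k)).length := fun k => by
    have := partner_lt (hdup k)
    simp only [List.length_append, List.length_singleton] at this
    omega
  have hxfk : ∀ k, ((l (φ k) ++ [w (φ k)]).take (partner (hdup k))).prod = x ∧
      (((l (φ k) ++ [w (φ k)]).take (partner (hdup k))).drop p).prod = f := fun k => by
    have := (hφ' k).1.2
    simp only [xf, dif_pos (hdup k), hld k, Prod.mk.injEq] at this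
    exact this
  let j : ℕ → ℕ := fun k => cutPos l (φ k) (partner (hdup k))
  set i := cutPos l (n₀ + 1) p with hi
  have hcut : ∀ k, cutPos l (φ k) p = i := fun k => hstable _ (hφ' k).2
  have hij : ∀ k, i < j k := fun k => by
    rw [← hcut k]
    exact (htr (φ k)).strictMono (hpl k) (hpr k)
  have hjφ : ∀ k, j k ≤ φ k := fun k => by
    have := (htr (φ k)).mono (hpr k) le_rfl
    rwa [(htr (φ k)).last] at this
  have hφj : ∀ k, φ k < j (k + 1) := fun k => by
    have h1 := hnext (φ k) (hφ' k).2 (hφ' k).1.1 (φ (k + 1)) (hφ (Nat.lt_succ_self k))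
    exact h1.trans ((htr (φ (k + 1))).mono (hpl (k + 1)) (hpr (k + 1)))
  have hupd : ∀ k b, b ≤ (l (φ k)).length →
      Function.update (cutPos l (φ k)) ((l (φ k)).length + 1) (φ k + 1) b = cutPos l (φ k) b :=
    fun k b hb => Function.update_of_ne (by omega) _ _
  have hseg : ∀ k, wprod w i (j k) = f := fun k => by
    have h1 := (htr (φ k)).append.prod_segment (hpl k).le
      (by simpa using (hpr k).trans (Nat.le_succ _))
    rw [(hxfk k).2, hupd k _ ((hpl k).le.trans (hpr k)), hupd k _ (hpr k), hcut k] at h1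
    exact h1.symm
  have heq : ∀ k, wprod w i (φ k + 1) = wprod w (j k) (φ k + 1) := fun k => by
    have h1 := prod_drop_leader (hdup k)
    have h2 := hpl k
    have h3 := hpr k
    rw [hld k, (htr (φ k)).append.prod_drop (by simp; omega),
      (htr (φ k)).append.prod_drop (by simp; omega), hupd k _ (h2.le.trans h3), hupd k _ h3,
      hcut k] at h1
    exact h1
  refine ⟨j, x, f, strictMono_nat_of_lt_succ fun k => (hjφ k).trans_lt (hφj k),
    (Nat.zero_le i).trans_lt (hij 0), ?_, fun k => ?_, ?_⟩
  · have h1 := (htr (φ 0)).append.prod_take (a := partner (hdup 0))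
      (by simpa using (hpr 0).trans (Nat.le_succ _))
    rw [(hxfk 0).1, hupd 0 _ (hpr 0)] at h1
    exact h1.symm
  · have h1 := hjφ k
    have h2 := hφj k
    have h3 := hij k
    rw [← wprod_mul w (show j k ≤ φ k + 1 by omega) (show φ k + 1 ≤ j (k + 1) by omega), ← heq k,
      wprod_mul w (by omega) (by omega), hseg]
  · rw [hm.parityEven_iff]
    have h1 := (hφ' 0).1.1
    rw [hc_dup _ (hdup 0), hld 0, (hxfk 0).1, (hxfk 0).2] at h1
    rw [← h1]
    split_ifs with hg
    · simp [hg]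
    · simp [hg]

end Factorization

section Traces

variable {A : Type} {K : ℕ}

/-- Sets of triples `(a, k, b)`, recording that some path leads from `a` to `b` with maximal
priority `k`. -/
def TraceRel (A : Type) (K : ℕ) : Type := Set (A × Fin (K + 1) × A)

namespace TraceRel

/-- `x.Mem a k b` states that `(a, k, b)` belongs to `x`. -/
def Mem (x : TraceRel A K) (a : A) (k : Fin (K + 1)) (b : A) : Prop :=
  (show Set (A × Fin (K + 1) × A) from x) (a, k, b)

theorem ext {x y : TraceRel A K} (h : ∀ a k b, x.Mem a k b ↔ y.Mem a k b) : x = y :=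
  funext fun t => propext (h t.1 t.2.1 t.2.2)

instance [Finite A] : Finite (TraceRel A K) :=
  inferInstanceAs (Finite (Set (A × Fin (K + 1) × A)))

instance : One (TraceRel A K) := ⟨fun t => t.1 = t.2.2 ∧ t.2.1 = 0⟩

instance : Mul (TraceRel A K) :=
  ⟨fun x y t => ∃ b p q, x.Mem t.1 p b ∧ y.Mem b q t.2.2 ∧ t.2.1 = max p q⟩

theorem mem_one {a b : A} {k : Fin (K + 1)} : (1 : TraceRel A K).Mem a k b ↔ a = b ∧ k = 0 :=
  Iff.rfl

theorem mem_mul {x y : TraceRel A K} {a b : A} {k : Fin (K + 1)} :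
    (x * y).Mem a k b ↔ ∃ c p q, x.Mem a p c ∧ y.Mem c q b ∧ k = max p q :=
  Iff.rfl

instance : Monoid (TraceRel A K) where
  mul_assoc x y z := ext fun a k b => by
    simp only [mem_mul]
    constructor
    · rintro ⟨c, p, q, ⟨d, p', q', h1, h2, rfl⟩, h3, rfl⟩
      exact ⟨d, p', max q' q, h1, ⟨c, q', q, h2, h3, rfl⟩, max_assoc _ _ _⟩
    · rintro ⟨c, p, q, h1, ⟨d, p', q', h2, h3, rfl⟩, rfl⟩
      exact ⟨d, max p p', q', ⟨c, p, p', h1, h2, rfl⟩, h3, (max_assoc _ _ _).symm⟩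
  one_mul x := ext fun a k b => by
    simp only [mem_mul, mem_one]
    constructor
    · rintro ⟨c, p, q, ⟨rfl, rfl⟩, h, rfl⟩
      simpa using h
    · exact fun h => ⟨a, 0, k, ⟨rfl, rfl⟩, h, by simp⟩
  mul_one x := ext fun a k b => by
    simp only [mem_mul, mem_one]
    constructor
    · rintro ⟨c, p, q, h, ⟨rfl, rfl⟩, rfl⟩
      simpa using h
    · exact fun h => ⟨b, k, 0, h, ⟨rfl, rfl⟩, by simp⟩

end TraceRel

theorem mem_wprod_iff {w : ℕ → TraceRel A K} {i j : ℕ} (hij : i ≤ j) {a b : A}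
    {k : Fin (K + 1)} :
    (wprod w i j).Mem a k b ↔ ∃ (α : ℕ → A) (π : ℕ → Fin (K + 1)), α i = a ∧ α j = b ∧
      (∀ n, i ≤ n → n < j → (w n).Mem (α n) (π n) (α (n + 1))) ∧
      (k : ℕ) = (Finset.Ico i j).sup fun n => (π n : ℕ) := by
  induction j, hij using Nat.le_induction generalizing b k with
  | base =>
    rw [wprod_self, TraceRel.mem_one]
    constructor
    · rintro ⟨rfl, rfl⟩
      exact ⟨fun _ => a, fun _ => 0, rfl, rfl, fun n h1 h2 => by omega, by simp⟩
    · rintro ⟨α, π, rfl, rfl, -, h⟩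
      exact ⟨rfl, Fin.ext (by simpa using h)⟩
  | succ j hij ih =>
    have hIco : Finset.Ico i (j + 1) = insert j (Finset.Ico i j) := by
      ext n
      simp only [Finset.mem_Ico, Finset.mem_insert]
      omega
    rw [wprod_succ w hij, TraceRel.mem_mul]
    constructor
    · rintro ⟨c, p, q, h1, h2, rfl⟩
      obtain ⟨α, π, h3, h4, h5, h6⟩ := ih.1 h1
      refine ⟨Function.update α (j + 1) b, Function.update π j q, ?_, by simp, fun n hn hn' => ?_,
        ?_⟩
      · rw [Function.update_of_ne (by omega), h3]
      · rcases Nat.lt_succ_iff_lt_or_eq.1 hn' with h | rfl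
        · rw [Function.update_of_ne (by omega), Function.update_of_ne (by omega),
            Function.update_of_ne (by omega)]
          exact h5 n hn h
        · rw [Function.update_of_ne (by omega), Function.update_self, Function.update_self, h4]
          exact h2
      · rw [hIco, Finset.sup_insert, Function.update_self, max_comm, Fin.coe_max, h6]
        congr 1
        refine Finset.sup_congr rfl fun n hn => ?_
        have := Finset.mem_Ico.1 hn
        rw [Function.update_of_ne (by omega)]
    · rintro ⟨α, π, h1, h2, h3, h4⟩
      have hK : ((Finset.Ico i j).sup fun n => (π n : ℕ)) < K + 1 :=
        (Finset.sup_lt_iff (Nat.succ_pos K)).2 fun n _ => (π n).2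
      refine ⟨α j, ⟨_, hK⟩, π j, ih.2 ⟨α, π, h1, rfl, fun n hn hn' => h3 n hn (by omega), rfl⟩,
        h2 ▸ h3 j hij (Nat.lt_succ_self j), Fin.ext ?_⟩
      rw [h4, hIco, Finset.sup_insert, Fin.coe_max, max_comm]

/-- All infinite traces of `w` starting in `a₀` satisfy the parity condition. -/
def AllTracesEven (a₀ : A) (w : ℕ → TraceRel A K) : Prop :=
  ∀ (α : ℕ → A) (π : ℕ → Fin (K + 1)), α 0 = a₀ →
    (∀ n, (w n).Mem (α n) (π n) (α (n + 1))) → ParityEven fun n => π n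

theorem allTracesEven_block_iff {a₀ : A} {w : ℕ → TraceRel A K} {j : ℕ → ℕ} (hj : StrictMono j)
    (h0 : j 0 = 0) :
    AllTracesEven a₀ (fun n => wprod w (j n) (j (n + 1))) ↔ AllTracesEven a₀ w := by
  constructor
  · intro h α π hα hπ
    rw [← parityEven_block_iff (fun n => Nat.lt_succ_iff.1 (π n).2) hj h0]
    have hK : ∀ n, ((Finset.Ico (j n) (j (n + 1))).sup fun n => (π n : ℕ)) < K + 1 := fun n =>
      (Finset.sup_lt_iff (Nat.succ_pos K)).2 fun n _ => (π n).2
    exact h (fun n => α (j n)) (fun n => ⟨_, hK n⟩) (by simp only [h0, hα]) fun n =>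
      (mem_wprod_iff (hj.monotone (Nat.le_succ n))).2
        ⟨α, π, rfl, rfl, fun m _ _ => hπ m, rfl⟩
  · intro h α π hα hπ
    choose β ρ h1 h2 h3 h4 using fun n => (mem_wprod_iff (hj.monotone (Nat.le_succ n))).1 (hπ n)
    choose B hB1 hB2 using exists_block hj h0
    have hB : ∀ n i, j n ≤ i → i < j (n + 1) → B i = n := fun n i hn hn' =>
      block_unique hj (hB1 i) (hB2 i) hn hn'
    have key := h (fun i => β (B i) i) (fun i => ρ (B i) i) ?_ fun i => ?_
    · rw [← parityEven_block_iff (fun n => Nat.lt_succ_iff.1 (ρ (B n) n).2) hj h0] at key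
      convert key using 2 with n
      rw [h4 n]
      refine Finset.sup_congr rfl fun i hi => ?_
      rw [hB n i (Finset.mem_Ico.1 hi).1 (Finset.mem_Ico.1 hi).2]
    · have : B 0 = 0 := hB 0 0 h0.le (by simpa [h0] using hj Nat.zero_lt_one)
      simp only [this]
      have := h1 0
      rw [h0] at this
      rw [this, hα]
    · have hstep := h3 (B i) i (hB1 i) (hB2 i)
      rcases Nat.lt_or_ge (i + 1) (j (B i + 1)) with hlt | hge
      · rw [hB (B i) (i + 1) ((hB1 i).trans (Nat.le_succ i)) hlt]
        exact hstep
      · have heq : i + 1 = j (B i + 1) := le_antisymm (hB2 i) hge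
        have hb : B (i + 1) = B i + 1 :=
          hB (B i + 1) (i + 1) heq.ge (heq ▸ hj (Nat.lt_succ_self _))
        have : β (B i + 1) (i + 1) = β (B i) (i + 1) := by
          rw [heq, h1, h2]
        rw [hb, this]
        exact hstep

/-- The labelled relation of a relation `R`, where each step has the priority of its source. -/
def traceLetter (Ω : A → Fin (K + 1)) (R : Set (A × A)) : TraceRel A K :=
  fun t => (t.1, t.2.2) ∈ R ∧ t.2.1 = Ω t.1

theorem allTracesEven_traceLetter_iff {a₀ : A} {Ω : A → Fin (K + 1)} {w : ℕ → Set (A × A)} :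
    AllTracesEven a₀ (fun n => traceLetter Ω (w n)) ↔
      ∀ α : ℕ → A, α 0 = a₀ → (∀ n, (α n, α (n + 1)) ∈ w n) →
        ParityEven fun n => Ω (α n) := by
  constructor
  · exact fun h α hα hw => h α (fun n => Ω (α n)) hα fun n => ⟨hw n, rfl⟩
  · intro h α π hα hw
    have : (fun n => (π n : ℕ)) = fun n => (Ω (α n) : ℕ) := funext fun n => by
      rw [show π n = Ω (α n) from (hw n).2]
    rw [this]
    exact h α hα fun n => (hw n).1

/-- The words of relations all of whose traces from `a₀` satisfy the parity condition are
recognized by a deterministic parity automaton. -/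
theorem exists_deterministic_parity [Finite A] (Ω : A → ℕ) (a₀ : A) :
    ∃ (Q : Type) (_ : Finite Q) (q₀ : Q) (δ : Q → Set (A × A) → Q) (Ω' : Q → ℕ),
      ∀ (w : ℕ → Set (A × A)) (q : ℕ → Q), q 0 = δ q₀ (w 0) →
        (∀ n, q (n + 1) = δ (q n) (w (n + 1))) →
        (ParityEven (fun n => Ω' (q n)) ↔
          ∀ α : ℕ → A, α 0 = a₀ → (∀ n, (α n, α (n + 1)) ∈ w n) →
            ParityEven fun n => Ω (α n)) := by
  obtain ⟨K, hK⟩ : ∃ K, ∀ a, Ω a ≤ K := by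
    obtain ⟨K, hK⟩ := (Set.finite_range Ω).bddAbove
    exact ⟨K, fun a => hK ⟨a, rfl⟩⟩
  let Ωf : A → Fin (K + 1) := fun a => ⟨Ω a, Nat.lt_succ_of_le (hK a)⟩
  let S := TraceRel A K
  let good : S → S → Prop := fun x f => AllTracesEven a₀ fun n => if n = 0 then x else f
  let N := Nat.card S + 1
  have hfin : Finite {l : List S // l.length ≤ Nat.card S} := List.finite_length_le S (Nat.card S)
  refine ⟨{l : List S // l.length ≤ Nat.card S} × Fin (2 * N + 2), inferInstance,
    (⟨[], Nat.zero_le _⟩, 0), fun q R =>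
      (⟨collapse (q.1.1 ++ [traceLetter Ωf R]),
        length_le_card_of_not_sufDup (not_sufDup_collapse _)⟩,
       ⟨collapsePrio good N (q.1.1 ++ [traceLetter Ωf R]),
        Nat.lt_succ_of_le (collapsePrio_le _ _ _)⟩),
    fun q => q.2, fun w q hq0 hq => ?_⟩
  let l : ℕ → List S := fun n => match n with
    | 0 => []
    | n + 1 => (q n).1.1
  have hl : ∀ n, l (n + 1) = collapse (l n ++ [traceLetter Ωf (w n)]) := fun n => by
    cases n with
    | zero => simp [l, hq0]
    | succ n => simp [l, hq n]
  have hpr : (fun n => ((q n).2 : ℕ)) =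
      fun n => collapsePrio good N (l n ++ [traceLetter Ωf (w n)]) := funext fun n => by
    cases n with
    | zero => simp [l, hq0]
    | succ n => simp [l, hq n]
  obtain ⟨j, x, f, hj, hj0, hx, hf, hiff⟩ := exists_ramsey_factorization good rfl hl
  rw [hpr, hiff, ← allTracesEven_traceLetter_iff (Ω := Ωf)]
  let j' : ℕ → ℕ := fun n => match n with
    | 0 => 0
    | n + 1 => j n
  have hj' : StrictMono j' := strictMono_nat_of_lt_succ fun n => by
    cases n with
    | zero => exact hj0
    | succ n => exact hj (Nat.lt_succ_self n)
  rw [← allTracesEven_block_iff hj' rfl]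
  refine iff_of_eq (congrArg (AllTracesEven a₀) (funext fun n => ?_))
  cases n with
  | zero => exact hx.symm
  | succ n => exact (hf n).symm

end Traces

section Definability

variable {T : SetFunctor} {F : LiftingFamily T} {W W' I J : Type}

theorem SOForm.sat_congr {X : Type} {α : T.obj X} (φ : SOForm F W) {V V' : W → Set X}
    (h : ∀ w ∈ φ.fv, V w = V' w) : φ.sat X α V ↔ φ.sat X α V' := by
  induction φ generalizing V V' with
  | subset a b => simp only [sat, h a (Or.inl rfl), h b (Or.inr rfl)]
  | lift i v =>
    simp only [sat]
    rw [show (fun k => V (v k)) = fun k => V' (v k) from funext fun k => h _ ⟨k, rfl⟩]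
  | neg φ ih => exact not_congr (ih h)
  | or φ ψ ih₁ ih₂ =>
    exact or_congr (ih₁ fun w hw => h w (Or.inl hw)) (ih₂ fun w hw => h w (Or.inr hw))
  | ex w φ ih =>
    refine exists_congr fun Z => ih fun w' hw' => ?_
    by_cases hw : w' = w
    · simp [updW, hw]
    · simpa [updW, hw] using h w' ⟨hw', hw⟩

theorem SOForm.finite_fv (φ : SOForm F W) : φ.fv.Finite := by
  induction φ with
  | subset a b => exact (Set.finite_singleton b).insert a
  | lift i v => exact Set.finite_range v
  | neg φ ih => exact ih
  | or φ ψ ih₁ ih₂ => exact ih₁.union ih₂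
  | ex w φ ih => exact ih.subset Set.sdiff_subset

/-- Renaming all (free and bound) variables of a formula. -/
def SOForm.rename_s5 (r : W → W') : SOForm F W → SOForm F W'
  | .subset a b => .subset (r a) (r b)
  | .lift i v => .lift i fun k => r (v k)
  | .neg φ => .neg (φ.rename_s5 r)
  | .or φ ψ => .or (φ.rename_s5 r) (ψ.rename_s5 r)
  | .ex w φ => .ex (r w) (φ.rename_s5 r)

theorem SOForm.sat_rename_s5 {r : W → W'} (hr : Function.Injective r) {X : Type} {α : T.obj X}
    (φ : SOForm F W) (V : W' → Set X) :
    (φ.rename_s5 r).sat X α V ↔ φ.sat X α fun w => V (r w) := by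
  induction φ generalizing V with
  | subset a b => rfl
  | lift i v => rfl
  | neg φ ih => exact not_congr (ih V)
  | or φ ψ ih₁ ih₂ => exact or_congr (ih₁ V) (ih₂ V)
  | ex w φ ih =>
    refine exists_congr fun Z => (ih _).trans (iff_of_eq (congrArg _ (funext fun w' => ?_)))
    simp only [updW, hr.eq_iff]

/-- Existential quantification over a list of variables. -/
def SOForm.exs_s5 (l : List W) (φ : SOForm F W) : SOForm F W := l.foldr .ex φ

theorem SOForm.fv_exs_s5 (l : List W) (φ : SOForm F W) : (φ.exs_s5 l).fv = φ.fv \ {w | w ∈ l} := by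
  induction l with
  | nil => simp [exs_s5]
  | cons a l ih =>
    change (φ.exs_s5 l).fv \ {a} = _
    rw [ih]
    ext w
    simp only [Set.mem_sdiff, Set.mem_ofPred_eq, Set.mem_singleton_iff, List.mem_cons]
    tauto

theorem SOForm.sat_exs_s5 {X : Type} {α : T.obj X} (l : List W) (φ : SOForm F W) (V : W → Set X) :
    (φ.exs_s5 l).sat X α V ↔ ∃ V', (∀ w, w ∉ l → V' w = V w) ∧ φ.sat X α V' := by
  induction l generalizing V with
  | nil =>
    constructor
    · exact fun h => ⟨V, fun _ _ => rfl, h⟩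
    · rintro ⟨V', h, h'⟩
      rwa [← show V' = V from funext fun w => h w List.not_mem_nil]
  | cons a l ih =>
    change (∃ Z, (φ.exs_s5 l).sat X α (updW V a Z)) ↔ _
    constructor
    · rintro ⟨Z, h⟩
      obtain ⟨V', h1, h2⟩ := (ih _).1 h
      refine ⟨V', fun w hw => ?_, h2⟩
      rw [List.mem_cons, not_or] at hw
      rw [h1 w hw.2, updW, if_neg hw.1]
    · rintro ⟨V', h1, h2⟩
      refine ⟨V' a, (ih _).2 ⟨V', fun w hw => ?_, h2⟩⟩
      by_cases hwa : w = a
      · simp [updW, hwa]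
      · rw [updW, if_neg hwa]
        exact h1 w (by simp [hwa, hw])

variable (F) in
/-- A property of one-step models over `I` defined by a second-order one-step formula,
irrespective of the values of the auxiliary variables. -/
def SODefinable (P : ∀ X : Type, T.obj X → (I → Set X) → Prop) : Prop :=
  ∃ φ : SOForm F (I ⊕ ℕ), ∀ (X : Type) (α : T.obj X) (V : I → Set X) (E : ℕ → Set X),
    φ.sat X α (Sum.elim V E) ↔ P X α V

theorem IsSentence.sodefinable {φ : SOForm F (I ⊕ ℕ)} (hφ : IsSentence φ) :
    SODefinable F fun X α V => φ.sat0 X α V :=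
  ⟨φ, fun X α V E => φ.sat_congr fun w hw => by
    obtain ⟨a, rfl⟩ := hφ w hw
    rfl⟩

namespace SODefinable

variable {P P' : ∀ X : Type, T.obj X → (I → Set X) → Prop}

theorem congr (h : SODefinable F P) (hP : ∀ X α V, P X α V ↔ P' X α V) : SODefinable F P' := by
  obtain ⟨φ, hφ⟩ := h
  exact ⟨φ, fun X α V E => (hφ X α V E).trans (hP X α V)⟩

theorem exists_sentence (h : SODefinable F P) :
    ∃ φ : SOForm F (I ⊕ ℕ), IsSentence φ ∧ ∀ X α V, φ.sat0 X α V ↔ P X α V := by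
  obtain ⟨φ, hφ⟩ := h
  let l := (φ.finite_fv.subset (Set.inter_subset_left (t := Set.range Sum.inr))).toFinset.toList
  have hl : ∀ w, w ∈ l ↔ w ∈ φ.fv ∧ w ∈ Set.range Sum.inr := by simp [l]
  refine ⟨φ.exs_s5 l, fun w hw => ?_, fun X α V => ?_⟩
  · rw [SOForm.fv_exs_s5] at hw
    cases w with
    | inl a => exact ⟨a, rfl⟩
    | inr n => exact absurd ((hl _).2 ⟨hw.1, n, rfl⟩) hw.2
  · rw [SOForm.sat0, SOForm.sat_exs_s5]
    constructor
    · rintro ⟨V', h1, h2⟩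
      rw [← hφ X α V fun n => V' (Sum.inr n)]
      convert h2 using 1
      funext w
      cases w with
      | inl a => exact (h1 _ fun h => by simpa using ((hl (Sum.inl a)).1 h).2).symm
      | inr n => rfl
    · exact fun h => ⟨_, fun _ _ => rfl, (hφ X α V _).2 h⟩

theorem not (h : SODefinable F P) : SODefinable F fun X α V => ¬ P X α V := by
  obtain ⟨φ, hφ⟩ := h
  exact ⟨.neg φ, fun X α V E => not_congr (hφ X α V E)⟩

theorem or (h : SODefinable F P) (h' : SODefinable F P') :
    SODefinable F fun X α V => P X α V ∨ P' X α V := by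
  obtain ⟨φ, hφ⟩ := h
  obtain ⟨φ', hφ'⟩ := h'
  exact ⟨.or φ φ', fun X α V E => or_congr (hφ X α V E) (hφ' X α V E)⟩

theorem and (h : SODefinable F P) (h' : SODefinable F P') :
    SODefinable F fun X α V => P X α V ∧ P' X α V :=
  (h.not.or h'.not).not.congr fun X α V => by tauto

theorem imp (h : SODefinable F P) (h' : SODefinable F P') :
    SODefinable F fun X α V => P X α V → P' X α V :=
  (h.not.or h').congr fun X α V => by tauto

theorem subset (a b : I) : SODefinable F fun X (_ : T.obj X) V => V a ⊆ V b :=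
  ⟨.subset (.inl a) (.inl b), fun _ _ _ _ => Iff.rfl⟩

theorem top : SODefinable F fun X (_ : T.obj X) (_ : I → Set X) => True :=
  ⟨.subset (.inr 0) (.inr 0), fun _ _ _ _ => iff_of_true subset_rfl trivial⟩

theorem imp_const (p : Prop) (h : p → SODefinable F P) :
    SODefinable F fun X α V => p → P X α V := by
  by_cases hp : p
  · exact (h hp).congr fun X α V => by simp [hp]
  · exact top.congr fun X α V => by simp [hp]

theorem forall_finite {ι : Type} [Finite ι]
    {P : ι → ∀ X : Type, T.obj X → (I → Set X) → Prop} (h : ∀ i, SODefinable F (P i)) :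
    SODefinable F fun X α V => ∀ i, P i X α V := by
  have := Fintype.ofFinite ι
  have key : ∀ s : Finset ι, SODefinable F fun X α V => ∀ i ∈ s, P i X α V := fun s => by
    induction s using Finset.induction_on with
    | empty => exact top.congr fun X α V => by simp
    | insert a s _ ih =>
      exact ((h a).and ih).congr fun X α V => by simp
  exact (key Finset.univ).congr fun X α V => by simp

theorem comap {P : ∀ X : Type, T.obj X → (J → Set X) → Prop} (h : SODefinable F P) {r : J → I}
    (hr : Function.Injective r) : SODefinable F fun X α V => P X α fun a => V (r a) := by
  obtain ⟨φ, hφ⟩ := h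
  refine ⟨φ.rename_s5 (Sum.map r id), fun X α V E => ?_⟩
  rw [SOForm.sat_rename_s5 (hr.sumMap Function.injective_id)]
  refine Iff.trans ?_ (hφ X α (fun a => V (r a)) E)
  refine iff_of_eq (congrArg _ (funext fun w => ?_))
  cases w <;> rfl

theorem exists_finite [Finite J] {P : ∀ X : Type, T.obj X → (I ⊕ J → Set X) → Prop}
    (h : SODefinable F P) :
    SODefinable F fun X α V => ∃ Z : J → Set X, P X α (Sum.elim V Z) := by
  obtain ⟨φ, hφ⟩ := h
  obtain ⟨e, he⟩ := exists_injective_nat (J ⊕ ℕ)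
  have := Fintype.ofFinite J
  let r : (I ⊕ J) ⊕ ℕ → I ⊕ ℕ := Sum.elim (Sum.map id fun z => e (.inl z)) fun n => .inr (e (.inr n))
  have hr : Function.Injective r := by
    rintro ((a | a) | a) ((b | b) | b) hab <;>
      simp [r, he.eq_iff] at hab ⊢ <;> exact hab
  let l : List (I ⊕ ℕ) := (Finset.univ : Finset J).toList.map fun z => .inr (e (.inl z))
  have hl : ∀ w, w ∈ l ↔ ∃ z, Sum.inr (e (.inl z)) = w := by simp [l]
  refine ⟨(φ.rename_s5 r).exs_s5 l, fun X α V E => ?_⟩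
  rw [SOForm.sat_exs_s5]
  constructor
  · rintro ⟨V', h1, h2⟩
    rw [SOForm.sat_rename_s5 hr] at h2
    refine ⟨fun z => V' (.inr (e (.inl z))), ?_⟩
    rw [← hφ X α _ fun n => V' (.inr (e (.inr n)))]
    convert h2 using 1
    funext w
    rcases w with (a | z) | n
    · exact (h1 (.inl a) (by simp [hl])).symm
    · rfl
    · rfl
  · rintro ⟨Z, hZ⟩
    let V' : I ⊕ ℕ → Set X := Sum.elim V fun n =>
      if h : ∃ z, e (.inl z) = n then Z h.choose else E n
    refine ⟨V', fun w hw => ?_, ?_⟩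
    · cases w with
      | inl a => rfl
      | inr n =>
        rw [hl] at hw
        have : ¬ ∃ z, e (.inl z) = n := fun ⟨z, hz⟩ => hw ⟨z, by rw [hz]⟩
        simp only [V', Sum.elim_inr, dif_neg this]
    · rw [SOForm.sat_rename_s5 hr]
      rw [← hφ X α _ fun n => V' (.inr (e (.inr n)))] at hZ
      convert hZ using 1
      funext w
      rcases w with (a | z) | n
      · rfl
      · have hex : ∃ z', e (Sum.inl z') = e (Sum.inl z) := ⟨z, rfl⟩
        have : hex.choose = z := Sum.inl_injective (he hex.choose_spec)
        change (if h : ∃ z', e (.inl z') = e (.inl z) then Z h.choose else _) = Z z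
        rw [dif_pos hex, this]
      · rfl

theorem forall_finite_sets [Finite J] {P : ∀ X : Type, T.obj X → (I ⊕ J → Set X) → Prop}
    (h : SODefinable F P) :
    SODefinable F fun X α V => ∀ Z : J → Set X, P X α (Sum.elim V Z) :=
  h.not.exists_finite.not.congr fun X α V => by simp

/-- The variables in a finite set cover the variable `a`. -/
theorem subset_iUnion [Finite J] (a : I) (r : J → I) :
    SODefinable F fun X (_ : T.obj X) V => V a ⊆ ⋃ j, V (r j) := by
  have h : SODefinable F fun X (_ : T.obj X) (V : I ⊕ Unit → Set X) =>
      (∀ j, V (.inl (r j)) ⊆ V (.inr ())) → V (.inl a) ⊆ V (.inr ()) :=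
    (forall_finite fun j => subset _ _).imp (subset _ _)
  refine h.forall_finite_sets.congr fun X _ V => ?_
  simp only [Sum.elim_inl, Sum.elim_inr]
  exact ⟨fun h => h (fun _ => ⋃ j, V (r j)) fun j => Set.subset_iUnion (fun j => V (r j)) j,
    fun h Z hZ => h.trans (Set.iUnion_subset hZ)⟩

theorem inter_eq_empty (a b : I) :
    SODefinable F fun X (_ : T.obj X) V => V a ∩ V b = ∅ := by
  have h : SODefinable F fun X (_ : T.obj X) (V : I ⊕ Bool → Set X) =>
      V (.inr true) ⊆ V (.inl a) → V (.inr true) ⊆ V (.inl b) →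
        V (.inr true) ⊆ V (.inr false) :=
    (subset _ _).imp ((subset _ _).imp (subset _ _))
  refine h.forall_finite_sets.congr fun X _ V => ?_
  simp only [Sum.elim_inl, Sum.elim_inr]
  constructor
  · intro h
    exact Set.subset_empty_iff.1
      (h (fun i => if i = Bool.true then V a ∩ V b else ∅) (by simp) (by simp))
  · intro h Z h1 h2
    exact ((Set.subset_inter h1 h2).trans h.subset).trans (Set.empty_subset _)

/-- Substituting finite unions of variables for the variables of a definable property. -/
theorem subst_iUnion [Finite J] {κ : J → Type} [∀ a, Finite (κ a)]
    {P : ∀ X : Type, T.obj X → (J → Set X) → Prop} (h : SODefinable F P) (r : ∀ a, κ a → I) :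
    SODefinable F fun X α V => P X α fun a => ⋃ k, V (r a k) := by
  have h' : SODefinable F fun X α (V : I ⊕ J → Set X) =>
      (∀ a, V (.inr a) ⊆ ⋃ k, V (.inl (r a k))) ∧ (∀ a, ∀ k, V (.inl (r a k)) ⊆ V (.inr a)) ∧
        P X α fun a => V (.inr a) :=
    (forall_finite fun a => subset_iUnion _ fun k => .inl (r a k)).and
      ((forall_finite fun a => forall_finite fun k => subset _ _).and (h.comap Sum.inr_injective))
  refine h'.exists_finite.congr fun X α V => ?_
  simp only [Sum.elim_inl, Sum.elim_inr]
  constructor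
  · rintro ⟨Z, h1, h2, h3⟩
    convert h3 using 2 with a
    exact (Set.iUnion_subset (h2 a)).antisymm (h1 a)
  · exact fun h => ⟨_, fun a => subset_rfl, fun a k => Set.subset_iUnion (fun k => V (r a k)) k, h⟩

end SODefinable

end Definability

section Simulation

variable {T : SetFunctor} {F : LiftingFamily T}

theorem soReach_iff {aut : SOAutomaton T F} {M : TreeModel T}
    {st : List (aut.St × M.S) → aut.St → Set M.S} {h : List (aut.St × M.S)} :
    SOReach aut M st h ↔ HistReach (fun h => {q | q.2 ∈ st h q.1}) (aut.aI, M.root) h := by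
  constructor <;> intro hr
  · induction hr with
    | base => exact .base
    | step _ h ih => exact .step ih h
  · induction hr with
    | base => exact .base
    | step _ h ih => exact .step ih h

theorem exists_histPrefix_eq_cons {α : Type} (f : ℕ → α) (n : ℕ) :
    ∃ l, histPrefix f n = f n :: l := by
  cases n with
  | zero => exact ⟨[], histPrefix_zero f⟩
  | succ n => exact ⟨_, histPrefix_succ f n⟩

variable (aut : SOAutomaton T F) {Q : Type} (δ : Q → Set (aut.St × aut.St) → Q)

/-- The valuation `Z` is disjoint and makes the one-step formulas of all the states in the range
of the macro-state satisfied, when a variable `b` in the formula of `a` is read as the union of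
the macro-states relating `a` to `b`. -/
def MacroStep (x : Set (aut.St × aut.St) × Q) (c : Set ℕ) (X : Type) (α : T.obj X)
    (Z : Set (aut.St × aut.St) × Q → Set X) : Prop :=
  (∀ y z, y ≠ z → Z y ∩ Z z = ∅) ∧
    ∀ a, (∃ a', (a', a) ∈ x.1) →
      (aut.Δ a c).sat0 X α fun b => {t | ∃ R, (a, b) ∈ R ∧ t ∈ Z (R, δ x.2 R)}

theorem exists_macroStep_sentence [Finite Q] (x : Set (aut.St × aut.St) × Q) (c : Set ℕ) :
    ∃ φ : SOForm F ((Set (aut.St × aut.St) × Q) ⊕ ℕ), IsSentence φ ∧ ∀ X α V,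
      φ.sat0 X α V ↔ ∃ Z, (∀ y, Z y ⊆ V y) ∧ MacroStep aut δ x c X α Z := by
  have := aut.fin
  have h1 : SODefinable F fun X (_ : T.obj X)
      (V : (Set (aut.St × aut.St) × Q) ⊕ (Set (aut.St × aut.St) × Q) → Set X) =>
      ∀ y, V (.inr y) ⊆ V (.inl y) := .forall_finite fun y => .subset _ _
  have h2 : SODefinable F fun X (_ : T.obj X)
      (V : (Set (aut.St × aut.St) × Q) ⊕ (Set (aut.St × aut.St) × Q) → Set X) =>
      ∀ y z, y ≠ z → V (.inr y) ∩ V (.inr z) = ∅ :=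
    .forall_finite fun y => .forall_finite fun z => .imp_const _ fun _ => .inter_eq_empty _ _
  have h3 : SODefinable F fun X (α : T.obj X)
      (V : (Set (aut.St × aut.St) × Q) ⊕ (Set (aut.St × aut.St) × Q) → Set X) =>
      ∀ a, (∃ a', (a', a) ∈ x.1) → (aut.Δ a c).sat0 X α fun b =>
        ⋃ k : {R : Set (aut.St × aut.St) // (a, b) ∈ R}, V (.inr (k.1, δ x.2 k.1)) :=
    .forall_finite fun a => .imp_const _ fun _ =>
      (aut.sentence a c).sodefinable.subst_iUnion fun b
        (k : {R : Set (aut.St × aut.St) // (a, b) ∈ R}) => Sum.inr (k.1, δ x.2 k.1)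
  refine (((h1.and (h2.and h3)).exists_finite).congr fun X α V => ?_).exists_sentence
  refine exists_congr fun Z => and_congr Iff.rfl (and_congr Iff.rfl
    (forall_congr' fun a => imp_congr_right fun _ => iff_of_eq (congrArg _ (funext fun b => ?_))))
  ext t
  simp

/-- The subset construction, with macro-states the binary relations on states paired with the
states of a deterministic automaton reading sequences of such relations. -/
noncomputable def simAutomaton [Finite Q] (q₀ : Q) (Ω' : Q → ℕ) : SOAutomaton T F where
  P := aut.P
  Pfin := aut.Pfin
  St := Set (aut.St × aut.St) × Q
  fin := have := aut.fin; inferInstance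
  aI := ({(aut.aI, aut.aI)}, δ q₀ {(aut.aI, aut.aI)})
  Ω x := Ω' x.2
  Δ x c := (exists_macroStep_sentence aut δ x c).choose
  sentence x c := (exists_macroStep_sentence aut δ x c).choose_spec.1

variable [Finite Q] (q₀ : Q) (Ω' : Q → ℕ)

theorem simAutomaton_sat0 (x : Set (aut.St × aut.St) × Q) (c : Set ℕ) {X : Type} {α : T.obj X}
    {V : Set (aut.St × aut.St) × Q → Set X} :
    ((simAutomaton aut δ q₀ Ω').Δ x c).sat0 X α V ↔
      ∃ Z, (∀ y, Z y ⊆ V y) ∧ MacroStep aut δ x c X α Z :=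
  (exists_macroStep_sentence aut δ x c).choose_spec.2 X α V

theorem simAutomaton_nonDet : (simAutomaton aut δ q₀ Ω').NonDet := by
  intro x c X α V h
  obtain ⟨Z, hZ, hs⟩ := (simAutomaton_sat0 aut δ q₀ Ω' x c).1 h
  exact ⟨Z, hZ, hs.1, (simAutomaton_sat0 aut δ q₀ Ω' x c).2 ⟨Z, fun _ => subset_rfl, hs⟩⟩

variable {aut δ q₀ Ω'}

theorem simAutomaton_accepts_of_accepts {M : TreeModel T}
    (hQ : ∀ (w : ℕ → Set (aut.St × aut.St)) (q : ℕ → Q), q 0 = δ q₀ (w 0) →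
      (∀ n, q (n + 1) = δ (q n) (w (n + 1))) →
      (∀ α : ℕ → aut.St, α 0 = aut.aI → (∀ n, (α n, α (n + 1)) ∈ w n) →
        ParityEven fun n => aut.Ω (α n)) → ParityEven fun n => Ω' (q n))
    (h : aut.Accepts M) : (simAutomaton aut δ q₀ Ω').Accepts M := by
  have := aut.fin
  obtain ⟨st, hleg, hwin⟩ := h
  obtain ⟨K, hK⟩ := (Set.finite_range aut.Ω).bddAbove
  replace hK : ∀ a, aut.Ω a ≤ K := fun a => hK ⟨a, rfl⟩
  obtain ⟨H, hH, hpos⟩ := exists_positional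
    (fun h : List (aut.St × M.S) => {q | q.2 ∈ st h q.1}) (aut.aI, M.root)
    (c := fun p => aut.Ω p.1) (fun p => hK p.1) hwin
  let U : aut.St → M.S → aut.St → Set M.S := fun a s => st ((a, s) :: H (a, s))
  let L : Set (aut.St × aut.St) → M.S → M.S → Set (aut.St × aut.St) := fun R s t =>
    {p | (∃ a', (a', p.1) ∈ R) ∧ t ∈ U p.1 s p.2}
  let st' : List ((Set (aut.St × aut.St) × Q) × M.S) → Set (aut.St × aut.St) × Q → Set M.S :=
    fun h y => {t | ∃ x s h₀, h = (x, s) :: h₀ ∧ M.R s t ∧ y = (L x.1 s t, δ x.2 (L x.1 s t))}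
  have mem_st' : ∀ x s h₀ y t, t ∈ st' ((x, s) :: h₀) y ↔
      M.R s t ∧ y = (L x.1 s t, δ x.2 (L x.1 s t)) := by
    intro x s h₀ y t
    constructor
    · rintro ⟨x', s', h', he, h1, h2⟩
      simp only [List.cons.injEq, Prod.mk.injEq] at he
      obtain ⟨⟨rfl, rfl⟩, rfl⟩ := he
      exact ⟨h1, h2⟩
    · rintro ⟨h1, h2⟩
      exact ⟨x, s, h₀, rfl, h1, h2⟩
  have hinv : ∀ h, SOReach (simAutomaton aut δ q₀ Ω') M st' h → ∀ x s h₀, h = (x, s) :: h₀ →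
      ∀ a, (∃ a', (a', a) ∈ x.1) → SOReach aut M st ((a, s) :: H (a, s)) := by
    intro h hr
    induction hr with
    | base =>
      rintro x s h₀ he a ⟨a', ha⟩
      simp only [List.cons.injEq, Prod.mk.injEq] at he
      obtain ⟨⟨rfl, rfl⟩, -⟩ := he
      obtain ⟨-, rfl⟩ := Prod.mk.inj (Set.mem_singleton_iff.1 ha)
      exact soReach_iff.2 (hH _ _ .base)
    | @step h p q hr hq ih =>
      rintro y t h₀ he a ⟨a', ha⟩
      obtain ⟨rfl, -⟩ := List.cons.inj he
      obtain ⟨x, s⟩ := p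
      obtain ⟨-, rfl⟩ := (mem_st' x s h y t).1 hq
      obtain ⟨h1, h2⟩ := ha
      exact soReach_iff.2 (hH _ _ ((soReach_iff.1 (ih x s h rfl a' h1)).step h2))
  refine ⟨st', fun h x s hr => ⟨fun y t ht => ((mem_st' x s h y t).1 ht).1, ?_⟩,
    fun f h0 hf => ?_⟩
  · refine (simAutomaton_sat0 aut δ q₀ Ω' x _).2 ⟨_, fun y => subset_rfl, fun y z hyz => ?_,
      fun a ha => ?_⟩
    · refine Set.eq_empty_iff_forall_notMem.2 fun t ht => hyz ?_
      exact ((mem_st' x s h y t.1).1 ht.1).2.trans ((mem_st' x s h z t.1).1 ht.2).2.symm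
    · change (aut.Δ a (aut.color M s)).sat0 _ _ _
      convert (hleg _ a s (hinv _ hr x s h rfl a ha)).2 using 1
      funext b
      ext t
      constructor
      · rintro ⟨R, hR, ht⟩
        obtain ⟨-, he⟩ := (mem_st' x s h _ t.1).1 ht
        obtain ⟨rfl, -⟩ := Prod.mk.inj he
        exact hR.2
      · exact fun ht => ⟨L x.1 s t.1, ⟨ha, ht⟩, (mem_st' x s h _ t.1).2 ⟨t.2, rfl⟩⟩
  · have hstep : ∀ n, (f (n + 1)).1 = (L (f n).1.1 (f n).2 (f (n + 1)).2,
        δ (f n).1.2 (L (f n).1.1 (f n).2 (f (n + 1)).2)) := fun n => by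
      obtain ⟨l, hl⟩ := exists_histPrefix_eq_cons f n
      have := hf n
      rw [hl] at this
      exact ((mem_st' (f n).1 (f n).2 l _ _).1 this).2
    refine hQ (fun n => (f n).1.1) (fun n => (f n).1.2) ?_ (fun n => ?_) fun α hα0 hα => ?_
    · rw [h0]
      rfl
    · simp only [hstep n]
    · have h1 : α 1 = aut.aI := by
        have := hα 0
        simp only [h0] at this
        exact (Prod.mk.inj (Set.mem_singleton_iff.1 this)).2
      refine (parityEven_succ_iff fun i => hK (α i)).1
        (hpos (fun n => (α (n + 1), (f n).2)) ?_ fun n => ?_)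
      · simp only [zero_add, h1, h0]
        exact hH _ _ .base
      · have := hα (n + 1)
        simp only [hstep n] at this
        exact this.2

theorem accepts_of_simAutomaton_accepts {M : TreeModel T}
    (hQ : ∀ (w : ℕ → Set (aut.St × aut.St)) (q : ℕ → Q), q 0 = δ q₀ (w 0) →
      (∀ n, q (n + 1) = δ (q n) (w (n + 1))) → (ParityEven fun n => Ω' (q n)) →
      ∀ α : ℕ → aut.St, α 0 = aut.aI → (∀ n, (α n, α (n + 1)) ∈ w n) →
        ParityEven fun n => aut.Ω (α n))
    (h : (simAutomaton aut δ q₀ Ω').Accepts M) : aut.Accepts M := by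
  have := aut.fin
  obtain ⟨st', hleg, hwin⟩ := h
  obtain ⟨K, hK⟩ := (Set.finite_range aut.Ω).bddAbove
  replace hK : ∀ a, aut.Ω a ≤ K := fun a => hK ⟨a, rfl⟩
  let xI : Set (aut.St × aut.St) × Q := ({(aut.aI, aut.aI)}, δ q₀ {(aut.aI, aut.aI)})
  have hZ : ∀ h' : List ((Set (aut.St × aut.St) × Q) × M.S),
      ∃ Z : Set (aut.St × aut.St) × Q → Set M.S, ∀ x s l, h' = (x, s) :: l →
        SOReach (simAutomaton aut δ q₀ Ω') M st' h' →
        (∀ y, Z y ⊆ st' h' y ∧ Z y ⊆ {t | M.R s t}) ∧ (∀ y z t, t ∈ Z y → t ∈ Z z → y = z) ∧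
        ∀ a, (∃ a', (a', a) ∈ x.1) →
          (aut.Δ a (aut.color M s)).sat0 {t : M.S // M.R s t} (M.σloc s) fun b =>
            {t | ∃ R, (a, b) ∈ R ∧ t.1 ∈ Z (R, δ x.2 R)} := by
    intro h'
    by_cases hr : ∃ x s l, h' = (x, s) :: l ∧ SOReach (simAutomaton aut δ q₀ Ω') M st' h'
    · obtain ⟨x, s, l, rfl, hr⟩ := hr
      obtain ⟨Z, hZ1, hZ2, hZ3⟩ := (simAutomaton_sat0 aut δ q₀ Ω' x _).1 (hleg l x s hr).2
      refine ⟨fun y => Subtype.val '' Z y, fun x' s' l' he _ => ?_⟩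
      simp only [List.cons.injEq, Prod.mk.injEq] at he
      obtain ⟨⟨rfl, rfl⟩, rfl⟩ := he
      refine ⟨fun y => ⟨?_, ?_⟩, ?_, fun a ha => ?_⟩
      · rintro _ ⟨t, ht, rfl⟩
        exact hZ1 y ht
      · rintro _ ⟨t, ht, rfl⟩
        exact t.2
      · rintro y z _ ⟨t, ht, rfl⟩ ⟨t', ht', he⟩
        obtain rfl := Subtype.ext he
        by_contra hyz
        exact (hZ2 y z hyz).subset ⟨ht, ht'⟩
      · have h3 : (aut.Δ a (aut.color M s)).sat0 _ _ _ := hZ3 a ha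
        convert h3 using 1
        funext b
        ext t
        simp [Subtype.val_injective.mem_set_image]
    · exact ⟨fun _ => ∅, fun x s l he hr' => absurd ⟨x, s, l, he, hr'⟩ hr⟩
  choose Z hZ using hZ
  let pick : List ((Set (aut.St × aut.St) × Q) × M.S) → M.S → Set (aut.St × aut.St) × Q :=
    fun l t => if h : ∃ y, t ∈ Z l y then h.choose else xI
  let lift : List (aut.St × M.S) → List ((Set (aut.St × aut.St) × Q) × M.S) := fun h =>
    h.foldr (fun p l => (if l = [] then xI else pick l p.2, p.2) :: l) []
  let st : List (aut.St × M.S) → aut.St → Set M.S := fun h b =>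
    {t | ∃ a s h₀ x l R, h = (a, s) :: h₀ ∧ lift h = (x, s) :: l ∧ (a, b) ∈ R ∧
      t ∈ Z (lift h) (R, δ x.2 R)}
  have mem_st : ∀ a s h₀ x l, lift ((a, s) :: h₀) = (x, s) :: l → ∀ b t,
      (t ∈ st ((a, s) :: h₀) b ↔ ∃ R, (a, b) ∈ R ∧ t ∈ Z (lift ((a, s) :: h₀)) (R, δ x.2 R)) := by
    intro a s h₀ x l hl b t
    constructor
    · rintro ⟨a', s', h', x', l', R, he, hl', h1, h2⟩
      rw [hl] at hl'
      simp only [List.cons.injEq, Prod.mk.injEq] at he hl'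
      obtain ⟨⟨rfl, rfl⟩, rfl⟩ := he
      obtain ⟨⟨rfl, -⟩, -⟩ := hl'
      exact ⟨R, h1, h2⟩
    · rintro ⟨R, h1, h2⟩
      exact ⟨a, s, h₀, x, l, R, rfl, hl, h1, h2⟩
  have hstep : ∀ a s h x l, lift ((a, s) :: h) = (x, s) :: l →
      SOReach (simAutomaton aut δ q₀ Ω') M st' (lift ((a, s) :: h)) →
      ∀ b t, t ∈ st ((a, s) :: h) b → ∃ R, (a, b) ∈ R ∧
        t ∈ st' (lift ((a, s) :: h)) (R, δ x.2 R) ∧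
        lift ((b, t) :: (a, s) :: h) = ((R, δ x.2 R), t) :: lift ((a, s) :: h) := by
    intro a s h x l hl hr b t ht
    obtain ⟨R, h1, h2⟩ := (mem_st a s h x l hl b t).1 ht
    obtain ⟨h3, h4, -⟩ := hZ _ x s l hl hr
    have hex : ∃ y, t ∈ Z (lift ((a, s) :: h)) y := ⟨_, h2⟩
    have hpick : pick (lift ((a, s) :: h)) t = (R, δ x.2 R) := by
      simp only [pick, dif_pos hex]
      exact h4 _ _ t hex.choose_spec h2
    refine ⟨R, h1, (h3 _).1 h2, ?_⟩
    rw [← hpick]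
    change (if lift ((a, s) :: h) = [] then xI else _, t) :: _ = _
    rw [if_neg (by simp [hl])]
  have hinv : ∀ h, SOReach aut M st h → ∀ a s h₀, h = (a, s) :: h₀ →
      SOReach (simAutomaton aut δ q₀ Ω') M st' (lift h) ∧
      ∃ x l, lift h = (x, s) :: l ∧ ∃ a', (a', a) ∈ x.1 := by
    intro h hr
    induction hr with
    | base =>
      intro a s h₀ he
      simp only [List.cons.injEq, Prod.mk.injEq] at he
      obtain ⟨⟨rfl, rfl⟩, -⟩ := he
      exact ⟨.base, xI, [], rfl, aut.aI, rfl⟩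
    | @step h p q hr hq ih =>
      intro b t h₀ he
      obtain ⟨rfl, -⟩ := List.cons.inj he
      obtain ⟨a, s⟩ := p
      obtain ⟨hr', x, l, hl, -⟩ := ih a s h rfl
      obtain ⟨R, h1, h2, h3⟩ := hstep a s h x l hl hr' b t hq
      rw [h3]
      refine ⟨?_, _, _, rfl, a, h1⟩
      rw [hl] at hr' h2 ⊢
      exact hr'.step h2
  refine ⟨st, fun h a s hr => ?_, fun f h0 hf => ?_⟩
  · obtain ⟨hr', x, l, hl, ha⟩ := hinv _ hr a s h rfl
    obtain ⟨h1, -, h3⟩ := hZ _ x s l hl hr'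
    refine ⟨fun b t ht => ?_, ?_⟩
    · obtain ⟨R, -, h2⟩ := (mem_st a s h x l hl b t).1 ht
      exact (h1 _).2 h2
    · convert h3 a ha using 1
      funext b
      ext t
      exact mem_st a s h x l hl b t.1
  · have hreach : ∀ n, SOReach aut M st (histPrefix f n) := fun n => by
      induction n with
      | zero => rw [histPrefix_zero, h0]; exact .base
      | succ n ih =>
        have := hf n
        rw [histPrefix_succ]
        obtain ⟨l, hl⟩ := exists_histPrefix_eq_cons f n
        rw [hl] at ih this ⊢
        exact ih.step this
    have hlift : ∀ n, SOReach (simAutomaton aut δ q₀ Ω') M st' (lift (histPrefix f n)) ∧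
        ∃ x l, lift (histPrefix f n) = (x, (f n).2) :: l := fun n => by
      obtain ⟨l, hl⟩ := exists_histPrefix_eq_cons f n
      obtain ⟨h1, x, l', h2, -⟩ := hinv _ (hreach n) (f n).1 (f n).2 l hl
      exact ⟨h1, x, l', h2⟩
    choose hr x l hl using hlift
    have hx0 : x 0 = xI := by
      have h1 := hl 0
      rw [histPrefix_zero] at h1
      change (xI, _) :: [] = _ at h1
      simp only [List.cons.injEq, Prod.mk.injEq] at h1
      exact h1.1.1.symm
    have hnext : ∀ n, ((f n).1, (f (n + 1)).1) ∈ (x (n + 1)).1 ∧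
        (x (n + 1)).2 = δ (x n).2 (x (n + 1)).1 ∧
        (f (n + 1)).2 ∈ st' (lift (histPrefix f n)) (x (n + 1)) ∧
        lift (histPrefix f (n + 1)) =
          (x (n + 1), (f (n + 1)).2) :: lift (histPrefix f n) := fun n => by
      obtain ⟨l', hl'⟩ := exists_histPrefix_eq_cons f n
      have h1 := hl n
      have h2 := hr n
      have h3 := hf n
      have h4 := hl (n + 1)
      rw [histPrefix_succ] at h4 ⊢
      rw [hl'] at h1 h2 h3 h4 ⊢
      obtain ⟨R, h5, h6, h7⟩ := hstep (f n).1 (f n).2 l' (x n) (l n) h1 h2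
        (f (n + 1)).1 (f (n + 1)).2 h3
      have h8 : x (n + 1) = (R, δ (x n).2 R) := by
        have := h4.symm.trans h7
        simp only [List.cons.injEq, Prod.mk.injEq] at this
        exact this.1.1
      rw [h8]
      exact ⟨h5, rfl, h6, h7⟩
    let f' : ℕ → (Set (aut.St × aut.St) × Q) × M.S := fun n => (x n, (f n).2)
    have hf' : ∀ n, histPrefix f' n = lift (histPrefix f n) := fun n => by
      induction n with
      | zero =>
        rw [histPrefix_zero, histPrefix_zero]
        change [(x 0, _)] = [(xI, _)]
        rw [hx0]
      | succ n ih => rw [histPrefix_succ, ih, (hnext n).2.2.2]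
    have hpar := hwin f' (by simp only [f', hx0, h0]; rfl) fun n =>
      (congrArg (fun l => (f (n + 1)).2 ∈ st' l (x (n + 1))) (hf' n)).mpr (hnext n).2.2.1
    refine (parityEven_succ_iff fun i => hK (Nat.casesOn i aut.aI fun n => (f n).1)).2
      (hQ (fun n => (x n).1) (fun n => (x n).2) (by simp only [hx0, xI])
        (fun n => (hnext n).2.1) hpar _ rfl fun n => ?_)
    cases n with
    | zero => simp [hx0, xI, h0]
    | succ n => exact (hnext n).1

end Simulation

/-- **Simulation Theorem.** Every monotone second-order `Λ`-automaton is
equivalent, over `T`-tree models, to a non-deterministic second-order `Λ`-automaton. -/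
theorem so_automaton_simulation (T : SetFunctor) (F : LiftingFamily T)
    (aut : SOAutomaton T F) (hmon : aut.Monotone') :
    ∃ aut' : SOAutomaton T F, aut'.P = aut.P ∧ aut'.NonDet ∧
      ∀ M : TreeModel T, aut'.Accepts M ↔ aut.Accepts M := by
  have := aut.fin
  obtain ⟨Q, _, q₀, δ, Ω', hQ⟩ := exists_deterministic_parity aut.Ω aut.aI
  exact ⟨simAutomaton aut δ q₀ Ω', rfl, simAutomaton_nonDet aut δ q₀ Ω', fun M =>
    ⟨accepts_of_simAutomaton_accepts fun w q h0 hs => (hQ w q h0 hs).1,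
      simAutomaton_accepts_of_accepts fun w q h0 hs => (hQ w q h0 hs).2⟩⟩
end

section
/- Let B be the finitary multiset (bag) functor. The assignment taking each pair (X, α) with α ∈ B X to the set X_* = {(u,i) | u ∈ X, i ∈ {0,…,α(u)−1}}, the multiset α_* ∈ B X_* with α_*(w) = 1 for all w ∈ X_*, and the projection h_α : X_* → X, (u,i) ↦ u, is a strongly adequate uniform construction for B: B(h_α)(α_*) = α for all (X,α), and for every map f : X → Y and all α ∈ B X, β ∈ B Y with B f(α) = β, there exists a bijection g : X_* → Y_* such that B g(α_*) = β_* and f ∘ h_α = h_β ∘ g. -/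
/- The finitary multiset (bag) functor sends `X` to the finitely supported functions
`X →₀ ℕ`; its action on a map `h` is `Finsupp.mapDomain h`, i.e.
`(B h)(f)(w) = Σ_{h(v) = w} f(v)`. -/

/-- The carrier `X_*` of the uniform construction for the bag functor:
pairs `(u, i)` with `u ∈ X` and `i ∈ {0, …, α(u) - 1}`. -/
def BagStar {X : Type} (α : X →₀ ℕ) : Type := {p : X × ℕ // p.2 < α p.1}

lemma bagStar_finite {X : Type} (α : X →₀ ℕ) : Finite (BagStar α) := by
  have hsub : {p : X × ℕ | p.2 < α p.1} ⊆
      (↑α.support : Set X) ×ˢ Set.Iio (α.support.sup α + 1) := by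
    rintro ⟨u, i⟩ h
    have hu : u ∈ α.support := Finsupp.mem_support_iff.2 (by
      intro h0
      simp only [Set.mem_setOf_eq, h0] at h
      omega)
    refine ⟨hu, ?_⟩
    have : α u ≤ α.support.sup α := Finset.le_sup hu
    simp only [Set.mem_setOf_eq] at h
    simp only [Set.mem_Iio]
    omega
  have hfin : ({p : X × ℕ | p.2 < α p.1}).Finite :=
    Set.Finite.subset (Set.Finite.prod (α.support.finite_toSet) (Set.finite_Iio _)) hsub
  exact hfin.to_subtype

/-- The multiset `α_* ∈ B(X_*)` assigning multiplicity `1` to every element of `X_*`. -/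
noncomputable def bagStarEl {X : Type} (α : X →₀ ℕ) : BagStar α →₀ ℕ :=
  haveI := bagStar_finite α
  Finsupp.equivFunOnFinite.symm (fun _ => 1)

/-- The projection `h_α : X_* → X`, `(u, i) ↦ u`. -/
def bagStarProj {X : Type} (α : X →₀ ℕ) : BagStar α → X := fun p => p.1.1

lemma bagStarEl_apply {X : Type} (α : X →₀ ℕ) (p : BagStar α) : bagStarEl α p = 1 := rfl

/-- Pushing forward `α_*` counts the elements of the fibres. -/
lemma mapDomain_bagStarEl_apply {X Y : Type} (α : X →₀ ℕ) (h : BagStar α → Y) (y : Y) :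
    Finsupp.mapDomain h (bagStarEl α) y = Nat.card {p // h p = y} := by
  classical
  have := bagStar_finite α
  have := Fintype.ofFinite (BagStar α)
  rw [Finsupp.mapDomain, Finsupp.sum_fintype _ _ (fun _ => Finsupp.single_zero _),
    Finsupp.finsetSum_apply, Nat.card_eq_fintype_card, Fintype.card_subtype,
    Finset.card_filter]
  exact Finset.sum_congr rfl fun p _ => by
    rw [bagStarEl_apply, Finsupp.single_apply]

/-- The fibre of `h_α` over `x` is `{0, …, α(x) - 1}`. -/
def bagStarProjFiberEquiv {X : Type} (α : X →₀ ℕ) (x : X) :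
    {p // bagStarProj α p = x} ≃ Fin (α x) where
  toFun p := ⟨p.1.1.2, lt_of_lt_of_eq p.1.2 (congrArg α p.2)⟩
  invFun i := ⟨⟨(x, i), i.2⟩, rfl⟩
  left_inv := by rintro ⟨⟨⟨u, i⟩, hi⟩, rfl⟩; rfl
  right_inv _ := rfl

lemma mapDomain_bagStarProj {X : Type} (α : X →₀ ℕ) :
    Finsupp.mapDomain (bagStarProj α) (bagStarEl α) = α := by
  ext x
  rw [mapDomain_bagStarEl_apply, Nat.card_congr (bagStarProjFiberEquiv α x), Nat.card_fin]

lemma mapDomain_equiv_bagStarEl {X Y : Type} {α : X →₀ ℕ} {β : Y →₀ ℕ}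
    (e : BagStar α ≃ BagStar β) : Finsupp.mapDomain e (bagStarEl α) = bagStarEl β := by
  ext q
  rw [Finsupp.mapDomain_equiv_apply, bagStarEl_apply, bagStarEl_apply]

/-- Functions from finite types whose fibres have equal cardinalities differ by a bijection
of their domains. -/
lemma exists_equiv_comp_eq_of_card_fiber_eq {S T Y : Type*} [Finite S] [Finite T]
    (a : S → Y) (b : T → Y) (h : ∀ y, Nat.card {s // a s = y} = Nat.card {t // b t = y}) :
    ∃ e : S ≃ T, a = b ∘ e := by
  let φ (y : Y) : {s // a s = y} ≃ {t // b t = y} := (Finite.card_eq.mp (h y)).some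
  refine ⟨(Equiv.sigmaFiberEquiv a).symm.trans
    ((Equiv.sigmaCongrRight φ).trans (Equiv.sigmaFiberEquiv b)), funext fun s => ?_⟩
  exact (φ (a s) ⟨s, rfl⟩).2.symm

/-- The assignment `(X, α) ↦ (X_*, α_*, h_α)` is a strongly adequate
uniform construction for the bag functor `B`: `B(h_α)(α_*) = α`, and whenever
`B f (α) = β` there is a bijection `g : X_* → Y_*` with `B g (α_*) = β_*` and
`f ∘ h_α = h_β ∘ g`. -/
theorem bag_strongly_adequate_uniform_construction :
    (∀ (X : Type) (α : X →₀ ℕ),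
        Finsupp.mapDomain (bagStarProj α) (bagStarEl α) = α) ∧
    (∀ (X Y : Type) (f : X → Y) (α : X →₀ ℕ) (β : Y →₀ ℕ),
        Finsupp.mapDomain f α = β →
        ∃ g : BagStar α → BagStar β, Function.Bijective g ∧
          Finsupp.mapDomain g (bagStarEl α) = bagStarEl β ∧
          (f ∘ bagStarProj α) = (bagStarProj β ∘ g)) := by
  refine ⟨fun X α => mapDomain_bagStarProj α, fun X Y f α β hf => ?_⟩
  have := bagStar_finite α
  have := bagStar_finite β
  obtain ⟨e, he⟩ := exists_equiv_comp_eq_of_card_fiber_eq (f ∘ bagStarProj α) (bagStarProj β)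
    fun y => by
      rw [← mapDomain_bagStarEl_apply, ← mapDomain_bagStarEl_apply, Finsupp.mapDomain_comp,
        mapDomain_bagStarProj, mapDomain_bagStarProj, hf]
  exact ⟨e, e.bijective, mapDomain_equiv_bagStarEl e, he⟩
end

section
/- Every exponential polynomial functor admits a strongly adequate uniform construction: for every set functor T generated by the grammar T ::= C | Id | T×T | ∐_{i∈I} T_i | T^C (where C ranges over constant functors, Id is the identity functor, × is binary product, ∐ is coproduct, and T^C is X ↦ (T X)^C), there is a uniform construction F for T such that for every map f : X → Y and all α ∈ T X, β ∈ T Y with T f(α) = β, there is a bijection g : X_* → Y_* with T g(α_*) = β_* and f ∘ h_α = h_β ∘ g. -/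
/-- The grammar of exponential polynomial functors:
`T ::= C | Id | T × T | ∐_{i ∈ I} T_i | T^C`. -/
inductive EPF : Type 1
  | const (C : Type)
  | id
  | prod (t₁ t₂ : EPF)
  | coprod (I : Type) (t : I → EPF)
  | exp (t : EPF) (C : Type)

/-- The action of an exponential polynomial functor on sets. -/
def EPF.obj : EPF → Type → Type
  | .const C => fun _ => C
  | .id => fun X => X
  | .prod t₁ t₂ => fun X => t₁.obj X × t₂.obj X
  | .coprod I t => fun X => Σ i : I, (t i).obj X
  | .exp t C => fun X => C → t.obj X

/-- The action of an exponential polynomial functor on functions. -/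
def EPF.map : (t : EPF) → {X Y : Type} → (X → Y) → t.obj X → t.obj Y
  | .const _ => fun _ c => c
  | .id => fun f x => f x
  | .prod t₁ t₂ => fun f p => (t₁.map f p.1, t₂.map f p.2)
  | .coprod I t => fun f p => ⟨p.1, (t p.1).map f p.2⟩
  | .exp t C => fun f g => fun c => t.map f (g c)

theorem EPF.map_comp (t : EPF) {X Y Z : Type} (f : X → Y) (g : Y → Z) (α : t.obj X) :
    t.map g (t.map f α) = t.map (g ∘ f) α := by
  induction t with
  | const => rfl
  | id => rfl
  | prod t₁ t₂ ih₁ ih₂ => exact Prod.ext (ih₁ α.1) (ih₂ α.2)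
  | coprod _ t ih => exact Sigma.ext rfl (heq_of_eq (ih α.1 α.2))
  | exp t _ ih => exact funext fun c => ih (α c)

/-- Every exponential polynomial functor admits a strongly adequate
uniform construction: an assignment `(X, α) ↦ (X_*, α_*, h_α)` with
`T(h_α)(α_*) = α`, such that whenever `T f (α) = β` there is a bijection
`g : X_* → Y_*` with `T g (α_*) = β_*` and `f ∘ h_α = h_β ∘ g`. -/
theorem epf_strongly_adequate_uniform_construction (t : EPF) :
    ∃ (star : (X : Type) → t.obj X → Type)
      (el : (X : Type) → (α : t.obj X) → t.obj (star X α))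
      (h : (X : Type) → (α : t.obj X) → star X α → X),
      (∀ (X : Type) (α : t.obj X), t.map (h X α) (el X α) = α) ∧
      (∀ (X Y : Type) (f : X → Y) (α : t.obj X) (β : t.obj Y), t.map f α = β →
        ∃ g : star X α → star Y β, Function.Bijective g ∧
          t.map g (el X α) = el Y β ∧ (f ∘ h X α) = (h Y β ∘ g)) := by
  induction t with
  | const =>
    refine ⟨fun _ _ => Empty, fun _ α => α, fun _ _ => Empty.elim, fun _ _ => rfl, ?_⟩
    intro X Y f α β hαβ
    exact ⟨_root_.id, Function.bijective_id, hαβ, funext fun x => x.elim⟩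
  | id =>
    refine ⟨fun _ _ => Unit, fun _ _ => (), fun _ α _ => α, fun _ _ => rfl, ?_⟩
    intro X Y f α β hαβ
    exact ⟨_root_.id, Function.bijective_id, rfl, funext fun _ => hαβ⟩
  | prod t₁ t₂ ih₁ ih₂ =>
    obtain ⟨star₁, el₁, h₁, map_el₁, lift₁⟩ := ih₁
    obtain ⟨star₂, el₂, h₂, map_el₂, lift₂⟩ := ih₂
    refine ⟨fun X α => star₁ X α.1 ⊕ star₂ X α.2,
      fun X α => (t₁.map Sum.inl (el₁ X α.1), t₂.map Sum.inr (el₂ X α.2)),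
      fun X α => Sum.elim (h₁ X α.1) (h₂ X α.2), ?_, ?_⟩
    · intro X α
      refine Prod.ext ?_ ?_
      · exact (t₁.map_comp _ _ _).trans (map_el₁ X α.1)
      · exact (t₂.map_comp _ _ _).trans (map_el₂ X α.2)
    · rintro X Y f α _ rfl
      obtain ⟨g₁, bij₁, map_g₁, comm₁⟩ := lift₁ X Y f α.1 _ rfl
      obtain ⟨g₂, bij₂, map_g₂, comm₂⟩ := lift₂ X Y f α.2 _ rfl
      refine ⟨Sum.map g₁ g₂, Sum.map_bijective.2 ⟨bij₁, bij₂⟩, Prod.ext ?_ ?_, ?_⟩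
      · exact (t₁.map_comp _ _ _).trans
          ((t₁.map_comp g₁ Sum.inl _).symm.trans (congrArg _ map_g₁))
      · exact (t₂.map_comp _ _ _).trans
          ((t₂.map_comp g₂ Sum.inr _).symm.trans (congrArg _ map_g₂))
      · funext x
        cases x with
        | inl x => exact congrFun comm₁ x
        | inr x => exact congrFun comm₂ x
  | coprod I t ih =>
    choose star el h map_el lift using ih
    refine ⟨fun X α => star α.1 X α.2, fun X α => ⟨α.1, el α.1 X α.2⟩,
      fun X α => h α.1 X α.2, ?_, ?_⟩
    · intro X α
      exact Sigma.ext rfl (heq_of_eq (map_el α.1 X α.2))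
    · rintro X Y f α _ rfl
      obtain ⟨g, bij, map_g, comm⟩ := lift α.1 X Y f α.2 _ rfl
      exact ⟨g, bij, Sigma.ext rfl (heq_of_eq map_g), comm⟩
  | exp t C ih =>
    obtain ⟨star, el, h, map_el, lift⟩ := ih
    refine ⟨fun X α => Σ c : C, star X (α c),
      fun X α c => t.map (Sigma.mk c) (el X (α c)), fun X α p => h X (α p.1) p.2, ?_, ?_⟩
    · intro X α
      exact funext fun c => (t.map_comp _ _ _).trans (map_el X (α c))
    · rintro X Y f α _ rfl
      choose g bij map_g comm using fun c => lift X Y f (α c) _ rfl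
      refine ⟨Sigma.map _root_.id g,
        ⟨Function.injective_id.sigma_map fun c => (bij c).1,
          Function.surjective_id.sigma_map fun c => (bij c).2⟩, ?_, ?_⟩
      · exact funext fun c => (t.map_comp _ _ _).trans
          ((t.map_comp (g c) (Sigma.mk (β := fun c => star Y (t.map f (α c))) c) _).symm.trans
            (congrArg _ (map_g c)))
      · exact funext fun p => congrFun (comm p.1) p.2
end

section
/- Fix k ∈ ℕ. Let X, Y be sets, α ∈ M^* X, β ∈ M^* Y with N_α and N_β nonempty, let h : X → Y satisfy M^* h(α) = β, and let V : A → 𝒫(Y) be a valuation over a finite set A. Then (X_*, α_*, V_[h∘π_X]) ≈^{2^k} (Y_*, β_*, V_[π_Y]): for every 2^k-signature σ over A, the number of basic elements of N_{α_*} of signature σ with respect to V_[h∘π_X] and the number of basic elements of N_{β_*} of signature σ with respect to V_[π_Y] are either both infinite, or both finite and equal. -/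
open scoped Classical

/-- The monotone neighborhood functor on objects: upward-closed collections of subsets. -/
def MObj (X : Type) : Type :=
  {N : Set (Set X) // ∀ Z Z' : Set X, Z ∈ N → Z ⊆ Z' → Z' ∈ N}

/-- The action of the monotone neighborhood functor on maps. -/
def MMap {X Y : Type} (f : X → Y) (N : MObj X) : MObj Y :=
  ⟨{Z : Set Y | f ⁻¹' Z ∈ N.1}, fun _ _ hZ hsub => N.2 _ _ hZ (Set.preimage_mono hsub)⟩

lemma MMap_comp {X Y Z : Type} (f : X → Y) (g : Y → Z) (N : MObj X) :
    MMap g (MMap f N) = MMap (g ∘ f) N := rfl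

/-- A subset `S ⊆ X` supports `N ∈ M X` if `N` is the image of some monotone
neighborhood structure on `S` under the inclusion. -/
def Supports {X : Type} (S : Set X) (N : MObj X) : Prop :=
  ∃ N' : MObj S, MMap (Subtype.val : S → X) N' = N

lemma supports_image {X Y : Type} (f : X → Y) (S : Set X) (N : MObj X)
    (h : Supports S N) : Supports (f '' S) (MMap f N) := by
  obtain ⟨N', hN'⟩ := h
  refine ⟨MMap (fun s : S => (⟨f s.1, ⟨s.1, s.2, rfl⟩⟩ : f '' S)) N', ?_⟩
  calc MMap (Subtype.val : (f '' S) → Y)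
        (MMap (fun s : S => (⟨f s.1, ⟨s.1, s.2, rfl⟩⟩ : f '' S)) N')
      = MMap (f ∘ (Subtype.val : S → X)) N' := rfl
    _ = MMap f (MMap (Subtype.val : S → X) N') := rfl
    _ = MMap f N := by rw [hN']

/-- The functor `M^*`: pairs of a monotone neighborhood structure and a supporting set. -/
def MstarObj (X : Type) : Type :=
  {p : MObj X × Set X // Supports p.2 p.1}

/-- The neighborhood component `N_α` of `α ∈ M^* X`. -/
def MstarObj.N {X : Type} (α : MstarObj X) : Set (Set X) := α.1.1.1

/-- The support component `S_α` of `α ∈ M^* X`. -/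
def MstarObj.Sup {X : Type} (α : MstarObj X) : Set X := α.1.2

/-- The action of `M^*` on maps. -/
def MstarMap {X Y : Type} (f : X → Y) (α : MstarObj X) : MstarObj Y :=
  ⟨(MMap f α.1.1, f '' α.1.2), supports_image f _ _ α.2⟩

/-- The carrier `X_*` of the uniform construction for `M^*` (for a fixed `k`):
tuples `(u, i, Z, j)` with `i < 2^k`, `Z ⊆ S_α` and `u ∈ Z`. -/
def XstarT (k : ℕ) (X : Type) (α : MstarObj X) : Type :=
  {q : X × Fin (2 ^ k) × Set X × ℕ // q.1 ∈ q.2.2.1 ∧ q.2.2.1 ⊆ α.Sup}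

/-- The projection `π_X : X_* → X`. -/
def starPi (k : ℕ) (X : Type) (α : MstarObj X) : XstarT k X α → X :=
  fun q => q.1.1

/-- The basic element `⌈Y, j⌉ = {(u, i, Y, j) | u ∈ Y, i < 2^k}`. -/
def basicElem (k : ℕ) (X : Type) (α : MstarObj X) (Y : Set X) (j : ℕ) :
    Set (XstarT k X α) :=
  {q | q.1.2.2.1 = Y ∧ q.1.2.2.2 = j}

/-- The neighborhood structure `N_{α_*}`: a set is a neighborhood iff it contains a
basic element `⌈Y, j⌉` with `Y ∈ N_α` and `Y ⊆ S_α`. -/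
def starN (k : ℕ) (X : Type) (α : MstarObj X) : Set (Set (XstarT k X α)) :=
  {Z | ∃ (Y : Set X) (j : ℕ), Y ∈ α.N ∧ Y ⊆ α.Sup ∧ basicElem k X α Y j ⊆ Z}

lemma supports_univ {W : Type} (N : MObj W) : Supports Set.univ N :=
  ⟨MMap (fun w : W => (⟨w, trivial⟩ : (Set.univ : Set W))) N, rfl⟩

/-- The element `α_* ∈ M^*(X_*)`: the neighborhood structure `N_{α_*}` together with
the full support `S_{α_*} = X_*`. -/
def starEl (k : ℕ) (X : Type) (α : MstarObj X) : MstarObj (XstarT k X α) :=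
  ⟨(⟨starN k X α, fun Z Z' hZ hsub => by
      obtain ⟨Y, j, h1, h2, h3⟩ := hZ
      exact ⟨Y, j, h1, h2, h3.trans hsub⟩⟩, Set.univ),
    supports_univ _⟩

/-- The family of basic elements of `N_{α_*}`. -/
def basicFamily (k : ℕ) (X : Type) (α : MstarObj X) : Set (Set (XstarT k X α)) :=
  {B | ∃ (Y : Set X) (j : ℕ), Y ∈ α.N ∧ Y ⊆ α.Sup ∧ B = basicElem k X α Y j}

/-- The propositional type of an element `v` under a valuation `V`. -/
def ptype {A W : Type} (V : A → Set W) (v : W) : Set A := {a | v ∈ V a}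

/-- The `m`-signature of a set `B` under a valuation `V`: it assigns to each
propositional type `t` the number of elements of `B` of type `t`, truncated at `m`
(an infinite number of elements also yields the value `m`). -/
noncomputable def msig {A W : Type} (m : ℕ) (V : A → Set W) (B : Set W)
    (t : Set A) : ℕ :=
  if ({v ∈ B | ptype V v = t} : Set W).Finite
    then min m ({v ∈ B | ptype V v = t} : Set W).ncard
    else m

/-- Two one-step models over the construction match up to depth `n`: for every
`n`-signature, the corresponding sets of basic elements are both infinite, or both
finite of the same cardinality. -/
def MatchUpTo {A : Type} (n k : ℕ) (X : Type) (α : MstarObj X)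
    (V₁ : A → Set (XstarT k X α)) (Y : Type) (β : MstarObj Y)
    (V₂ : A → Set (XstarT k Y β)) : Prop :=
  ∀ σ : Set A → ℕ,
    (({B ∈ basicFamily k X α | msig n V₁ B = σ}).Infinite ∧
     ({B ∈ basicFamily k Y β | msig n V₂ B = σ}).Infinite) ∨
    (({B ∈ basicFamily k X α | msig n V₁ B = σ}).Finite ∧
     ({B ∈ basicFamily k Y β | msig n V₂ B = σ}).Finite ∧
     ({B ∈ basicFamily k X α | msig n V₁ B = σ}).ncard =
       ({B ∈ basicFamily k Y β | msig n V₂ B = σ}).ncard)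

/-- The signature taking the value `m` on the types in `T` and `0` elsewhere. -/
noncomputable def typeSig {A : Type} (m : ℕ) (T : Set (Set A)) (t : Set A) : ℕ :=
  if t ∈ T then m else 0

/-- Some nonempty neighborhood inside the support realizes exactly the types prescribed
by the signature `σ`. -/
def RealizesTypeSig (k : ℕ) {A X : Type} (α : MstarObj X) (V : A → Set X)
    (σ : Set A → ℕ) : Prop :=
  ∃ Z ∈ α.N, Z ⊆ α.Sup ∧ Z.Nonempty ∧ typeSig (2 ^ k) (ptype V '' Z) = σ

/-- Neighborhoods may be intersected with the support. -/
lemma MstarObj.inter_sup_mem {X : Type} (α : MstarObj X) {Z : Set X} (hZ : Z ∈ α.N) :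
    Z ∩ α.Sup ∈ α.N := by
  obtain ⟨N', hN'⟩ : ∃ N' : MObj α.Sup, MMap Subtype.val N' = α.1.1 := α.2
  have hN (W : Set X) : W ∈ α.N ↔ (Subtype.val ⁻¹' W : Set α.Sup) ∈ N'.1 := by
    change W ∈ α.1.1.1 ↔ _
    rw [← hN']
    rfl
  rwa [hN, Subtype.preimage_coe_inter_self, ← hN]

lemma msig_basicElem {k : ℕ} {A X : Type} (α : MstarObj X) (V : A → Set X) {Z : Set X}
    (hZ : Z ⊆ α.Sup) (j : ℕ) :
    msig (2 ^ k) (fun a => starPi k X α ⁻¹' V a) (basicElem k X α Z j) =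
      typeSig (2 ^ k) (ptype V '' Z) := by
  funext t
  unfold msig typeSig
  by_cases ht : t ∈ ptype V '' Z
  · rw [if_pos ht]
    obtain ⟨u, hu, hut⟩ := ht
    split_ifs with hfin
    · let f : Fin (2 ^ k) → XstarT k X α := fun i => ⟨(u, i, Z, j), hu, hZ⟩
      have hf : Function.Injective f := fun i i' hii =>
        congrArg (fun q : XstarT k X α => q.1.2.1) hii
      have hcard := Set.ncard_le_ncard (s := Set.range f)
        (by rintro _ ⟨i, rfl⟩; exact ⟨⟨rfl, rfl⟩, hut⟩) hfin
      rw [Set.ncard_range_of_injective hf, Nat.card_fin] at hcard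
      exact min_eq_left hcard
    · rfl
  · have hemp : {v ∈ basicElem k X α Z j |
        ptype (fun a => starPi k X α ⁻¹' V a) v = t} = ∅ := by
      rw [Set.eq_empty_iff_forall_notMem]
      rintro v ⟨hv, hvt⟩
      exact ht ⟨v.1.1, hv.1 ▸ v.2.1, hvt⟩
    simp [hemp, ht]

lemma basicElem_empty (k : ℕ) {X : Type} (α : MstarObj X) (j : ℕ) :
    basicElem k X α ∅ j = ∅ := by
  rw [Set.eq_empty_iff_forall_notMem]
  rintro v ⟨hv, -⟩
  exact absurd v.2.1 (by simp [hv])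

lemma basicElem_injective (k : ℕ) {X : Type} (α : MstarObj X) {Z : Set X}
    (hZ : Z ⊆ α.Sup) (hne : Z.Nonempty) :
    Function.Injective (basicElem k X α Z) := by
  obtain ⟨u, hu⟩ := hne
  intro j j' hjj
  have hmem : (⟨(u, ⟨0, by positivity⟩, Z, j), hu, hZ⟩ : XstarT k X α) ∈
      basicElem k X α Z j := ⟨rfl, rfl⟩
  rw [hjj] at hmem
  exact hmem.2

lemma basicFamily_msig_infinite {k : ℕ} {A X : Type} {α : MstarObj X} {V : A → Set X}
    {σ : Set A → ℕ} (hσ : RealizesTypeSig k α V σ) :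
    ({B ∈ basicFamily k X α |
      msig (2 ^ k) (fun a => starPi k X α ⁻¹' V a) B = σ}).Infinite := by
  obtain ⟨Z, hZN, hZ, hne, rfl⟩ := hσ
  refine (Set.infinite_range_of_injective (basicElem_injective k α hZ hne)).mono ?_
  rintro _ ⟨j, rfl⟩
  exact ⟨⟨Z, j, hZN, hZ, rfl⟩, msig_basicElem α V hZ j⟩

/-- A signature that no nonempty neighborhood realizes belongs at most to the empty basic
element. -/
lemma basicFamily_msig_eq {k : ℕ} {A X : Type} {α : MstarObj X} {V : A → Set X}
    {σ : Set A → ℕ} (hσ : ¬ RealizesTypeSig k α V σ) :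
    {B ∈ basicFamily k X α | msig (2 ^ k) (fun a => starPi k X α ⁻¹' V a) B = σ} =
      {B | B = ∅ ∧ ∅ ∈ α.N ∧ typeSig (2 ^ k) (∅ : Set (Set A)) = σ} := by
  ext B
  constructor
  · rintro ⟨⟨Z, j, hZN, hZ, rfl⟩, hB⟩
    rw [msig_basicElem α V hZ] at hB
    rcases Z.eq_empty_or_nonempty with rfl | hne
    · exact ⟨basicElem_empty k α j, hZN, by simpa using hB⟩
    · exact absurd ⟨Z, hZN, hZ, hne, hB⟩ hσ
  · rintro ⟨rfl, hN, hB⟩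
    refine ⟨⟨∅, 0, hN, Set.empty_subset _, (basicElem_empty k α 0).symm⟩, ?_⟩
    rw [← basicElem_empty k α 0, msig_basicElem α V (Set.empty_subset _), Set.image_empty, hB]

lemma realizesTypeSig_map_iff {k : ℕ} {A X Y : Type} {α : MstarObj X} {β : MstarObj Y}
    {h : X → Y} (hmap : MstarMap h α = β) (V : A → Set Y) (σ : Set A → ℕ) :
    RealizesTypeSig k α (fun a => h ⁻¹' V a) σ ↔ RealizesTypeSig k β V σ := by
  subst hmap
  have himage (Z : Set X) : ptype V '' (h '' Z) = ptype (fun a => h ⁻¹' V a) '' Z :=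
    Set.image_image _ _ _
  constructor
  · rintro ⟨Z, hZN, hZ, hne, hσ⟩
    exact ⟨h '' Z, α.1.1.2 _ _ hZN (Set.subset_preimage_image h Z), Set.image_mono hZ,
      hne.image h, by rw [himage, hσ]⟩
  · rintro ⟨Z, hZN, hZ, hne, hσ⟩
    have hZim : h '' (h ⁻¹' Z ∩ α.Sup) = Z := by
      rw [Set.inter_comm, Set.image_inter_preimage]
      exact Set.inter_eq_right.2 hZ
    refine ⟨h ⁻¹' Z ∩ α.Sup, α.inter_sup_mem hZN, Set.inter_subset_right, ?_, ?_⟩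
    · rw [← hZim] at hne
      exact hne.of_image
    · rw [← himage, hZim, hσ]

/-- If `M^* h (α) = β`, with `N_α` and `N_β` nonempty, then for any
valuation `V` over a finite variable set `A`, the one-step models
`(X_*, α_*, V_[h∘π_X])` and `(Y_*, β_*, V_[π_Y])` match up to depth `2^k`. -/
theorem mstar_construction_matches (k : ℕ) (A : Type) (hA : Finite A)
    (X Y : Type) (α : MstarObj X) (β : MstarObj Y)
    (hα : α.N.Nonempty) (hβ : β.N.Nonempty)
    (h : X → Y) (hmap : MstarMap h α = β) (V : A → Set Y) :
    MatchUpTo (2 ^ k) k X α (fun a => (h ∘ starPi k X α) ⁻¹' V a)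
      Y β (fun a => starPi k Y β ⁻¹' V a) := by
  have hN : β.N = {Z | h ⁻¹' Z ∈ α.N} := by subst hmap; rfl
  have hempty : (∅ : Set Y) ∈ β.N ↔ (∅ : Set X) ∈ α.N := by rw [hN]; simp
  intro σ
  by_cases hσ : RealizesTypeSig k α (fun a => h ⁻¹' V a) σ
  · exact Or.inl ⟨basicFamily_msig_infinite hσ,
      basicFamily_msig_infinite ((realizesTypeSig_map_iff hmap V σ).1 hσ)⟩
  · right
    have hX := basicFamily_msig_eq hσ
    have hY := basicFamily_msig_eq (fun hb => hσ ((realizesTypeSig_map_iff hmap V σ).2 hb))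
    change ({B ∈ basicFamily k X α |
        msig (2 ^ k) (fun a => starPi k X α ⁻¹' (h ⁻¹' V a)) B = σ}).Finite ∧ _ ∧
      ({B ∈ basicFamily k X α |
        msig (2 ^ k) (fun a => starPi k X α ⁻¹' (h ⁻¹' V a)) B = σ}).ncard = _
    rw [hX, hY, hempty]
    by_cases hc : ∅ ∈ α.N ∧ typeSig (2 ^ k) (∅ : Set (Set A)) = σ <;> simp [hc]
end

section
/- Fix k ∈ ℕ, sets X, Y, α ∈ M^* X, β ∈ M^* Y with N_α and N_β nonempty, and h : X → Y with M^* h(α) = β. Let B be a finite set of variables, let 0 < m ≤ k, and let V₁ : B → 𝒫(X_*) and V₂ : B → 𝒫(Y_*) be valuations such that (X_*, α_*, V₁) ≈^{2^m} (Y_*, β_*, V₂). Then for any fresh variable q ∉ B: for every valuation V₁′ on B ∪ {q} extending V₁ there exists a valuation V₂′ on B ∪ {q} extending V₂ such that (X_*, α_*, V₁′) ≈^{2^{m−1}} (Y_*, β_*, V₂′); and symmetrically, for every extension V₂′ of V₂ there exists an extension V₁′ of V₁ with (X_*, α_*, V₁′) ≈^{2^{m−1}} (Y_*, β_*, V₂′).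 -/
open scoped Classical

/-- The propositional type of an element `v` relative to the variables in `B₀`. -/
def ptypeB {W : Type} (B₀ : Set ℕ) (V : ℕ → Set W) (v : W) : Set ℕ :=
  {b | b ∈ B₀ ∧ v ∈ V b}

/-- The `m`-signature of a set `B` under a valuation `V`, relative to the variables in
`B₀`: it assigns to each propositional type `t` the number of elements of `B` of type
`t`, truncated at `m` (an infinite number of elements also yields the value `m`). -/
noncomputable def msigB {W : Type} (m : ℕ) (B₀ : Set ℕ) (V : ℕ → Set W) (B : Set W)
    (t : Set ℕ) : ℕ :=
  if ({v ∈ B | ptypeB B₀ V v = t} : Set W).Finite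
    then min m ({v ∈ B | ptypeB B₀ V v = t} : Set W).ncard
    else m

/-- The two one-step models over the construction match up to depth `n`, relative to
the variables in `B₀`. -/
def MatchUpToB (n k : ℕ) (B₀ : Set ℕ) (X : Type) (α : MstarObj X)
    (V₁ : ℕ → Set (XstarT k X α)) (Y : Type) (β : MstarObj Y)
    (V₂ : ℕ → Set (XstarT k Y β)) : Prop :=
  ∀ σ : Set ℕ → ℕ,
    (({B ∈ basicFamily k X α | msigB n B₀ V₁ B = σ}).Infinite ∧
     ({B ∈ basicFamily k Y β | msigB n B₀ V₂ B = σ}).Infinite) ∨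
    (({B ∈ basicFamily k X α | msigB n B₀ V₁ B = σ}).Finite ∧
     ({B ∈ basicFamily k Y β | msigB n B₀ V₂ B = σ}).Finite ∧
     ({B ∈ basicFamily k X α | msigB n B₀ V₁ B = σ}).ncard =
       ({B ∈ basicFamily k Y β | msigB n B₀ V₂ B = σ}).ncard)

/-- A decomposition of the cardinality of a set is realised by a decomposition of the set. -/
lemma exists_subset_encard_eq_and_diff {ι : Type*} {B : Set ι} {a b : ℕ∞}
    (h : B.encard = a + b) : ∃ U ⊆ B, U.encard = a ∧ (B \ U).encard = b := by
  by_cases ha : a = ⊤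
  · by_cases hb : b = ⊤
    · subst ha hb
      have hB : B.Infinite := Set.encard_eq_top_iff.1 (by simpa using h)
      obtain ⟨t, u, rfl, hd, hc⟩ := hB.exists_union_disjoint_cardinal_eq_of_infinite
      have hfin : t.Finite ↔ u.Finite := by
        rw [← Cardinal.lt_aleph0_iff_set_finite, ← Cardinal.lt_aleph0_iff_set_finite, hc]
      have ht : t.Infinite := fun ht => hB (ht.union (hfin.1 ht))
      have hu : u.Infinite := fun hu => ht (hfin.2 hu)
      refine ⟨t, Set.subset_union_left, ht.encard_eq, ?_⟩
      rw [Set.union_sdiff_cancel_left hd.le_bot]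
      exact hu.encard_eq
    · obtain ⟨U, hU, hUb⟩ := Set.exists_subset_encard_eq (h ▸ le_add_self : b ≤ B.encard)
      refine ⟨B \ U, Set.sdiff_subset, ?_, ?_⟩
      · have := Set.encard_sdiff_add_encard_of_subset hU
        rw [h, hUb] at this
        exact WithTop.add_right_cancel hb this
      · rwa [Set.sdiff_sdiff_cancel_left hU]
  · obtain ⟨U, hU, hUa⟩ := Set.exists_subset_encard_eq (h ▸ le_self_add : a ≤ B.encard)
    refine ⟨U, hU, hUa, ?_⟩
    have := Set.encard_sdiff_add_encard_of_subset hU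
    rw [h, hUa, add_comm a] at this
    exact WithTop.add_right_cancel ha this

/-- A colouring with finitely many colours transfers along equality of `encard`. -/
lemma exists_coloring_encard_eq {ι κ T : Type*} [Nonempty T] {A : Set ι} {B : Set κ} (f : ι → T)
    (hf : (f '' A).Finite) (h : A.encard = B.encard) :
    ∃ g : κ → T, ∀ t, {b ∈ B | g b = t}.encard = {a ∈ A | f a = t}.encard := by
  obtain ⟨S, hS⟩ := hf.exists_finset_coe
  replace hS : ∀ a ∈ A, f a ∈ S := fun a ha => by
    rw [← Finset.mem_coe, hS]; exact Set.mem_image_of_mem f ha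
  clear hf
  induction S using Finset.induction_on generalizing A B with
  | empty =>
    have hA : A = ∅ := Set.eq_empty_of_forall_notMem fun a ha => by simpa using hS a ha
    subst hA
    have hB : B = ∅ := by simpa using h.symm
    subst hB
    exact ⟨fun _ => Classical.arbitrary T, by simp⟩
  | insert s S hs ih =>
    have hsplit : B.encard = {a ∈ A | f a = s}.encard + {a ∈ A | f a ≠ s}.encard := by
      rw [← h, ← Set.encard_union_eq]
      · congr 1; ext a; by_cases f a = s <;> simp_all
      · exact Set.disjoint_left.2 fun a ha hb => hb.2 ha.2
    obtain ⟨U, hU, hU1, hU2⟩ := exists_subset_encard_eq_and_diff hsplit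
    obtain ⟨g, hg⟩ := ih (A := {a ∈ A | f a ≠ s}) (B := B \ U) hU2.symm
      fun a ha => (Finset.mem_insert.1 (hS a ha.1)).resolve_left ha.2
    have hgs : ∀ b ∈ B \ U, g b ≠ s := fun b hb hbs => by
      have h0 := hg s
      rw [Set.encard_eq_zero.2 (by ext; simp : {a ∈ {a ∈ A | f a ≠ s} | f a = s} = ∅),
        Set.encard_eq_zero] at h0
      exact (h0 ▸ (⟨hb, hbs⟩ : b ∈ {b ∈ B \ U | g b = s}) : b ∈ (∅ : Set κ))
    refine ⟨fun b => if b ∈ U then s else g b, fun t => ?_⟩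
    by_cases ht : t = s
    · subst ht
      rw [← hU1]
      congr 1
      ext b
      by_cases hb : b ∈ U
      · simp [hb, hU hb]
      · simp only [Set.mem_ofPred_eq, hb, if_false, iff_false]
        exact fun hb' => hgs b ⟨hb'.1, hb⟩ hb'.2
    · have h1 : {b ∈ B | (if b ∈ U then s else g b) = t} = {b ∈ B \ U | g b = t} := by
        ext b
        by_cases hb : b ∈ U <;> simp [hb, Ne.symm ht]
      have h2 : {a ∈ A | f a = t} = {a ∈ {a ∈ A | f a ≠ s} | f a = t} := by
        ext a
        simp only [Set.mem_ofPred_eq]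
        constructor
        · rintro ⟨ha, rfl⟩; exact ⟨⟨ha, ht⟩, rfl⟩
        · rintro ⟨⟨ha, -⟩, rfl⟩; exact ⟨ha, rfl⟩
      rw [h1, h2, hg]

/-- Sets whose cardinalities agree up to `2 * n` admit matching splittings up to `n`. -/
lemma exists_subset_min_encard_eq {ι κ : Type*} {n : ℕ} {C : Set ι} {D : Set κ}
    (h : min (2 * n : ℕ∞) C.encard = min (2 * n : ℕ∞) D.encard) (Z : Set ι) :
    ∃ U ⊆ D, min (n : ℕ∞) U.encard = min (n : ℕ∞) (C ∩ Z).encard ∧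
      min (n : ℕ∞) (D \ U).encard = min (n : ℕ∞) (C \ Z).encard := by
  rw [← Set.encard_sdiff_add_encard_inter C Z] at h
  generalize (C ∩ Z).encard = a at h ⊢
  generalize (C \ Z).encard = b at h ⊢
  suffices H : ∃ a' b', D.encard = a' + b' ∧
      min (n : ℕ∞) a' = min (n : ℕ∞) a ∧ min (n : ℕ∞) b' = min (n : ℕ∞) b by
    obtain ⟨a', b', hab, ha, hb⟩ := H
    obtain ⟨U, hU, rfl, rfl⟩ := exists_subset_encard_eq_and_diff hab
    exact ⟨U, hU, ha, hb⟩
  generalize D.encard = d at h ⊢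
  by_cases hd : d = a + b
  · exact ⟨a, b, hd, rfl, rfl⟩
  obtain ⟨hab, hd'⟩ : (2 * n : ℕ∞) ≤ b + a ∧ (2 * n : ℕ∞) ≤ d := by
    rcases le_total (2 * n : ℕ∞) (b + a) with h1 | h1 <;> rcases le_total (2 * n : ℕ∞) d with h2 | h2 <;>
      simp_all [add_comm]
  rw [two_mul] at hab hd'
  have small (x y : ℕ∞) (hx : x ≤ n) (hxy : (n : ℕ∞) + n ≤ y + x) :
      n ≤ y ∧ ∃ e, d = x + e ∧ n ≤ e := by
    have hx_top : x ≠ ⊤ := (hx.trans_lt (ENat.natCast_lt_top n)).ne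
    refine ⟨WithTop.le_of_add_le_add_right (ENat.natCast_ne_top n) (hxy.trans (add_le_add_right hx y)), ?_⟩
    obtain ⟨e, rfl⟩ := exists_add_of_le ((hx.trans le_self_add).trans hd')
    exact ⟨e, rfl, WithTop.le_of_add_le_add_left hx_top ((add_le_add_left hx n).trans hd')⟩
  rcases le_total (n : ℕ∞) a with ha | ha
  · rcases le_total (n : ℕ∞) b with hb | hb
    · obtain ⟨e, rfl⟩ := exists_add_of_le hd'
      exact ⟨n, n + e, by rw [add_assoc], by simp [ha], by simp [hb]⟩
    · obtain ⟨ha', e, rfl, he⟩ := small b a hb (by rwa [add_comm a])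
      exact ⟨e, b, add_comm _ _, by simp [ha', he], rfl⟩
  · obtain ⟨hb', e, rfl, he⟩ := small a b ha hab
    exact ⟨a, e, rfl, rfl, by simp [hb', he]⟩

lemma coe_msigB {W : Type} (m : ℕ) (B₀ : Set ℕ) (V : ℕ → Set W) (B : Set W) (t : Set ℕ) :
    (msigB m B₀ V B t : ℕ∞) = min (m : ℕ∞) {v ∈ B | ptypeB B₀ V v = t}.encard := by
  unfold msigB
  split_ifs with hfin
  · rw [← hfin.cast_ncard_eq]
    exact Nat.mono_cast.map_min
  · rw [Set.Infinite.encard_eq hfin, min_eq_left le_top]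

lemma finite_range_msigB {W : Type} (m : ℕ) {B₀ : Set ℕ} (hB₀ : B₀.Finite)
    (V : ℕ → Set W) : (Set.range (msigB m B₀ V)).Finite := by
  have : Finite (𝒫 B₀) := hB₀.powerset
  refine (Set.finite_range fun (r : 𝒫 B₀ → Fin (m + 1)) (t : Set ℕ) =>
    if ht : t ∈ 𝒫 B₀ then (r ⟨t, ht⟩ : ℕ) else 0).subset ?_
  rintro _ ⟨B, rfl⟩
  have hle (t : Set ℕ) : msigB m B₀ V B t ≤ m := by
    rw [← Nat.cast_le (α := ℕ∞), coe_msigB]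
    exact min_le_left _ _
  refine ⟨fun t => ⟨msigB m B₀ V B t, Nat.lt_succ_of_le (hle t)⟩, funext fun t => ?_⟩
  by_cases ht : t ∈ 𝒫 B₀
  · simp only [ht, dif_pos]
  · simp only [ht, dif_neg, not_false_eq_true]
    symm
    rw [← Nat.cast_inj (R := ℕ∞), coe_msigB, Set.encard_eq_zero.2, Nat.cast_zero, min_zero]
    refine Set.eq_empty_of_forall_notMem fun v hv => ht ?_
    rw [← hv.2]
    exact fun b hb => hb.1

lemma ptypeB_insert_updW_eq_iff {W : Type} {B₀ : Set ℕ} {q : ℕ} (hq : q ∉ B₀)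
    (V : ℕ → Set W) (Z : Set W) (v : W) (t : Set ℕ) :
    ptypeB (insert q B₀) (updW V q Z) v = t ↔ ptypeB B₀ V v = t \ {q} ∧ (v ∈ Z ↔ q ∈ t) := by
  simp only [Set.ext_iff, ptypeB, updW, Set.mem_ofPred_eq, Set.mem_insert_iff, Set.mem_sdiff,
    Set.mem_singleton_iff]
  constructor
  · refine fun h => ⟨fun b => ?_, by simpa using h q⟩
    have := h b
    by_cases hb : b = q
    · subst hb; simp [hq]
    · simpa [hb] using this
  · rintro ⟨h1, h2⟩ b
    by_cases hb : b = q
    · subst hb; simpa using h2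
    · simpa [hb] using h1 b

lemma msigB_insert_updW_congr {W : Type} (n : ℕ) {B₀ : Set ℕ} {q : ℕ} (V : ℕ → Set W)
    {Z Z' B : Set W} (h : ∀ v ∈ B, v ∈ Z ↔ v ∈ Z') :
    msigB n (insert q B₀) (updW V q Z) B = msigB n (insert q B₀) (updW V q Z') B := by
  have key : ∀ v ∈ B, ptypeB (insert q B₀) (updW V q Z) v =
      ptypeB (insert q B₀) (updW V q Z') v := fun v hv => by
    ext b
    by_cases hb : b = q <;> simp [ptypeB, updW, hb, h v hv]
  funext t
  rw [← Nat.cast_inj (R := ℕ∞), coe_msigB, coe_msigB]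
  congr 2
  ext v
  exact and_congr_right fun hv => by rw [key v hv]

/-- An extension of the valuation on one set is answered on any set of the same signature. -/
lemma exists_msigB_insert_eq {W₁ W₂ : Type} {n : ℕ} {B₀ : Set ℕ} {q : ℕ} (hq : q ∉ B₀)
    {V₁ : ℕ → Set W₁} {V₂ : ℕ → Set W₂} {C : Set W₁} {D : Set W₂}
    (h : msigB (2 * n) B₀ V₁ C = msigB (2 * n) B₀ V₂ D) (Z₁ : Set W₁) :
    ∃ Z₂ : Set W₂, msigB n (insert q B₀) (updW V₂ q Z₂) D =
      msigB n (insert q B₀) (updW V₁ q Z₁) C := by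
  have h' (t : Set ℕ) : min (2 * (n : ℕ∞)) {v ∈ C | ptypeB B₀ V₁ v = t}.encard =
      min (2 * (n : ℕ∞)) {v ∈ D | ptypeB B₀ V₂ v = t}.encard := by
    have := congrArg (Nat.cast : ℕ → ℕ∞) (congrFun h t)
    rw [coe_msigB, coe_msigB] at this
    exact_mod_cast this
  choose U hUD hU hU' using fun t => exists_subset_min_encard_eq (h' t) Z₁
  refine ⟨{v | v ∈ U (ptypeB B₀ V₂ v)}, funext fun t => ?_⟩
  rw [← Nat.cast_inj (R := ℕ∞), coe_msigB, coe_msigB]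
  simp only [ptypeB_insert_updW_eq_iff hq]
  by_cases ht : q ∈ t
  · convert hU (t \ {q}) using 3
    · ext v
      simp only [ht, iff_true, Set.mem_ofPred_eq]
      constructor
      · rintro ⟨-, h1, h2⟩; rwa [h1] at h2
      · intro hv
        obtain ⟨h1, h2⟩ := hUD _ hv
        exact ⟨h1, h2, h2 ▸ hv⟩
    · ext v
      simp only [ht, iff_true, Set.mem_ofPred_eq, Set.mem_inter_iff, and_assoc]
  · convert hU' (t \ {q}) using 3
    · ext v
      simp only [ht, iff_false, Set.mem_ofPred_eq, Set.mem_sdiff, and_assoc]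
      refine and_congr_right fun _ => and_congr_right fun h1 => by rw [h1]
    · ext v
      simp only [ht, iff_false, Set.mem_ofPred_eq, Set.mem_sdiff, and_assoc,
        Set.sdiff_singleton_eq_self, not_false_eq_true]

lemma encard_eq_finsum_fiber {ι T : Type*} {A : Set ι} (f : ι → T) {S : Set T} (hS : S.Finite)
    (hf : ∀ a ∈ A, f a ∈ S) : A.encard = ∑ᶠ t ∈ S, {a ∈ A | f a = t}.encard := by
  rw [← hS.encard_biUnion]
  · congr 1
    ext a
    simp only [Set.mem_iUnion, Set.mem_ofPred_eq, exists_prop]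
    exact ⟨fun ha => ⟨f a, hf a ha, ha, rfl⟩, fun ⟨_, _, ha, _⟩ => ha⟩
  · exact fun s _ t _ hst => Set.disjoint_left.2 fun a ha hb => hst (ha.2.symm.trans hb.2)

/-- For pairwise disjoint families, an extension of the valuation on one side is answered on
the other, at the price of halving the depth. -/
lemma exists_extension_encard_eq {W₁ W₂ : Type} {F₁ : Set (Set W₁)} {F₂ : Set (Set W₂)}
    (hF₂ : F₂.PairwiseDisjoint id) {n : ℕ} {B₀ : Set ℕ} (hB₀ : B₀.Finite)
    {q : ℕ} (hq : q ∉ B₀) {V₁ : ℕ → Set W₁} {V₂ : ℕ → Set W₂}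
    (h : ∀ σ, {B ∈ F₁ | msigB (2 * n) B₀ V₁ B = σ}.encard =
      {B ∈ F₂ | msigB (2 * n) B₀ V₂ B = σ}.encard) (Z₁ : Set W₁) :
    ∃ Z₂ : Set W₂, ∀ τ,
      {B ∈ F₁ | msigB n (insert q B₀) (updW V₁ q Z₁) B = τ}.encard =
        {B ∈ F₂ | msigB n (insert q B₀) (updW V₂ q Z₂) B = τ}.encard := by
  choose g hg using fun σ => exists_coloring_encard_eq
    (msigB n (insert q B₀) (updW V₁ q Z₁))
    ((finite_range_msigB n (hB₀.insert q) (updW V₁ q Z₁)).subset (Set.image_subset_range _ _))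
    (h σ)
  have hex (D : Set W₂) (hD : D ∈ F₂) : ∃ Z : Set W₂,
      msigB n (insert q B₀) (updW V₂ q Z) D = g (msigB (2 * n) B₀ V₂ D) D := by
    set σ := msigB (2 * n) B₀ V₂ D with hσ
    have hne : {C ∈ {B ∈ F₁ | msigB (2 * n) B₀ V₁ B = σ} |
        msigB n (insert q B₀) (updW V₁ q Z₁) C = g σ D}.Nonempty := by
      rw [← Set.encard_ne_zero, ← hg σ, Set.encard_ne_zero]
      exact ⟨D, ⟨hD, hσ.symm⟩, rfl⟩
    obtain ⟨C, ⟨-, hC⟩, hC'⟩ := hne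
    rw [← hC']
    exact exists_msigB_insert_eq hq (hC.trans hσ) Z₁
  choose! Z hZ using hex
  have hext (D : Set W₂) (hD : D ∈ F₂) :
      msigB n (insert q B₀) (updW V₂ q {v | ∃ E ∈ F₂, v ∈ E ∧ v ∈ Z E}) D =
        g (msigB (2 * n) B₀ V₂ D) D := by
    rw [← hZ D hD]
    refine msigB_insert_updW_congr n V₂ fun v hv => ⟨?_, fun hvZ => ⟨D, hD, hv, hvZ⟩⟩
    rintro ⟨E, hE, hvE, hvZ⟩
    rwa [hF₂.elim_set hD hE v hv hvE]
  refine ⟨{v | ∃ E ∈ F₂, v ∈ E ∧ v ∈ Z E}, fun τ => ?_⟩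
  have hS := (finite_range_msigB (2 * n) hB₀ V₁).union (finite_range_msigB (2 * n) hB₀ V₂)
  rw [encard_eq_finsum_fiber (msigB (2 * n) B₀ V₁) hS fun a _ => Or.inl ⟨a, rfl⟩,
    encard_eq_finsum_fiber (msigB (2 * n) B₀ V₂) hS fun a _ => Or.inr ⟨a, rfl⟩]
  refine finsum_congr fun σ => finsum_congr fun _ => ?_
  convert (hg σ τ).symm using 2
  · ext C
    simp only [Set.mem_ofPred_eq]
    tauto
  · ext D
    simp only [Set.mem_ofPred_eq]
    constructor
    · rintro ⟨⟨hD, h1⟩, h2⟩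
      exact ⟨⟨hD, h2⟩, by rw [← h1, hext D hD, h2]⟩
    · rintro ⟨⟨hD, h1⟩, h2⟩
      exact ⟨⟨hD, by rw [hext D hD, h1, h2]⟩, h1⟩

lemma pairwiseDisjoint_basicFamily (k : ℕ) (X : Type) (α : MstarObj X) :
    (basicFamily k X α).PairwiseDisjoint id := by
  rintro _ ⟨Y, j, -, -, rfl⟩ _ ⟨Y', j', -, -, rfl⟩ hne
  refine Set.disjoint_left.2 fun v hv hv' => hne ?_
  rw [← hv.1, ← hv.2, ← hv'.1, ← hv'.2]

lemma matchUpToB_iff_encard_eq {n k : ℕ} {B₀ : Set ℕ} {X : Type} {α : MstarObj X}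
    {V₁ : ℕ → Set (XstarT k X α)} {Y : Type} {β : MstarObj Y} {V₂ : ℕ → Set (XstarT k Y β)} :
    MatchUpToB n k B₀ X α V₁ Y β V₂ ↔ ∀ σ,
      {B ∈ basicFamily k X α | msigB n B₀ V₁ B = σ}.encard =
        {B ∈ basicFamily k Y β | msigB n B₀ V₂ B = σ}.encard := by
  refine forall_congr' fun σ => ?_
  generalize {B ∈ basicFamily k X α | msigB n B₀ V₁ B = σ} = F
  generalize {B ∈ basicFamily k Y β | msigB n B₀ V₂ B = σ} = G
  constructor
  · rintro (⟨hF, hG⟩ | ⟨hF, hG, hc⟩)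
    · rw [hF.encard_eq, hG.encard_eq]
    · rw [← hF.cast_ncard_eq, ← hG.cast_ncard_eq, hc]
  · intro h
    rcases F.finite_or_infinite with hF | hF
    · have hG : G.Finite := Set.encard_lt_top_iff.1 (h ▸ hF.encard_lt_top)
      exact Or.inr ⟨hF, hG, by rw [Set.ncard, Set.ncard, h]⟩
    · exact Or.inl ⟨hF, Set.encard_eq_top_iff.1 (h ▸ hF.encard_eq)⟩

/-- A back-and-forth property for the construction: if the two
one-step models match up to depth `2^m` (over a finite variable set `B₀`, with
`0 < m ≤ k`), then for any fresh variable `q ∉ B₀`, any extension of either valuation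
with a value for `q` can be answered by an extension of the other valuation such that
the resulting models match up to depth `2^(m-1)` over `B₀ ∪ {q}`. -/
theorem mstar_construction_back_and_forth (k : ℕ) (X Y : Type)
    (α : MstarObj X) (β : MstarObj Y) (hα : α.N.Nonempty) (hβ : β.N.Nonempty)
    (h : X → Y) (hmap : MstarMap h α = β)
    (B₀ : Set ℕ) (hB₀ : B₀.Finite) (m : ℕ) (hm0 : 0 < m) (hmk : m ≤ k)
    (V₁ : ℕ → Set (XstarT k X α)) (V₂ : ℕ → Set (XstarT k Y β))
    (hmatch : MatchUpToB (2 ^ m) k B₀ X α V₁ Y β V₂)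
    (q : ℕ) (hq : q ∉ B₀) :
    (∀ Z₁ : Set (XstarT k X α), ∃ Z₂ : Set (XstarT k Y β),
      MatchUpToB (2 ^ (m - 1)) k (insert q B₀) X α (updW V₁ q Z₁) Y β (updW V₂ q Z₂)) ∧
    (∀ Z₂ : Set (XstarT k Y β), ∃ Z₁ : Set (XstarT k X α),
      MatchUpToB (2 ^ (m - 1)) k (insert q B₀) X α (updW V₁ q Z₁) Y β (updW V₂ q Z₂)) := by
  obtain ⟨m, rfl⟩ := Nat.exists_eq_succ_of_ne_zero hm0.ne'
  rw [Nat.succ_eq_add_one, pow_succ', matchUpToB_iff_encard_eq] at hmatch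
  simp only [Nat.succ_eq_add_one, Nat.add_sub_cancel, matchUpToB_iff_encard_eq]
  refine ⟨exists_extension_encard_eq (pairwiseDisjoint_basicFamily k Y β) hB₀ hq hmatch,
    fun Z₂ => ?_⟩
  obtain ⟨Z₁, hZ₁⟩ := exists_extension_encard_eq (pairwiseDisjoint_basicFamily k X α) hB₀ hq
    (fun σ => (hmatch σ).symm) Z₂
  exact ⟨Z₁, fun τ => (hZ₁ τ).symm⟩
end
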